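/- arXiv:2602.18302 — 2 statements merged into one kernel-verified Lean document; each statement's English description precedes it below -/
import Mathlib

section
/- Let α, δ ∈ ℂ with α ≠ 0, δ ≠ 0, α ≠ 1 and δ ≠ 1, let β, γ ∈ ℂ, and define f(x) = αx + β and g(x) = δx + γ. Let c₁, c₂ ∈ ℂ(x) be rational functions such that c₁ ≠ f^m in ℂ(x) for every integer m ≥ 1 and c₂ ≠ g^n in ℂ(x) for every integer n ≥ 1. If the set of λ ∈ ℂ that are not poles of c₁ or c₂ and for which there exist integers m, n ≥ 1 with f^m(λ) = c₁(λ) and g^n(λ) = c₂(λ) is infinite, then there exist a nonconstant rational function F ∈ ℂ(x), coprime nonzero integers p, q, and μ ∈ ℂ with μ ≠ 0 such that the set of pairs (m, n) of positive integers satisfying μ^q = α^(m·q) · δ^(−n·p) (integer powers) is infinite, and in ℂ(x) one has c₁ = μ·F^p·(X − β/(1−α)) + β/(1−α) and c₂ = F^q·(X − γ/(1−δ)) + γ/(1−δ). -/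
section MainMaterial

open Polynomial
/-- numerators -/
noncomputable def pT (a b n : ℕ) : ℤ[X] :=
  ∑ i ∈ Finset.range (b+1), C ((-1)^i * ((a+i).choose i : ℤ) * (n.choose (b-i) : ℤ)) * X^i
noncomputable def pP (a c n : ℕ) : ℤ[X] :=
  ∑ i ∈ Finset.range (c+1), C ((-1)^i * ((a+i).choose i : ℤ) * (n.choose (c-i) : ℤ)) * X^(c-i)

lemma beta_nat (m n : ℕ) : ∫ t in (0:ℝ)..1, t^m * (1-t)^n =
    (m.factorial * n.factorial : ℝ) / (m+n+1).factorial := by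
  induction n generalizing m with
  | zero =>
    simp [integral_pow, Nat.factorial_succ]
    have : (m.factorial : ℝ) ≠ 0 := by positivity
    field_simp
  | succ n ih =>
    have h1 : ∀ t ∈ Set.uIcc (0:ℝ) 1, HasDerivAt (fun t : ℝ => t^(m+1)/(m+1)) (t^m) t := by
      intro t _
      have := (hasDerivAt_pow (m+1) t).div_const ((m:ℝ)+1)
      refine this.congr_deriv ?_
      push_cast
      have : (m:ℝ)+1 ≠ 0 := by positivity
      field_simp
      try simp
    have h2 : ∀ t ∈ Set.uIcc (0:ℝ) 1, HasDerivAt (fun t : ℝ => (1-t)^(n+1)) (-((n+1)*(1-t)^n)) t := by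
      intro t _
      have := ((hasDerivAt_id t).const_sub 1).pow (n+1)
      refine this.congr_deriv ?_
      push_cast
      simp
    have := intervalIntegral.integral_mul_deriv_eq_deriv_mul h2 h1
      (Continuous.intervalIntegrable (by fun_prop) _ _) (Continuous.intervalIntegrable (by fun_prop) _ _)
    have e : ∫ t in (0:ℝ)..1, t^m * (1-t)^(n+1) = ∫ t in (0:ℝ)..1, (1-t)^(n+1) * t^m := by
      congr 1; ext t; ring
    rw [e, this]
    have e2 : ∫ t in (0:ℝ)..1, -((n+1)*(1-t)^n) * (t^(m+1)/(m+1)) =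
       -((n+1)/(m+1)) * ∫ t in (0:ℝ)..1, t^(m+1) * (1-t)^n := by
      rw [← intervalIntegral.integral_const_mul]
      congr 1; ext t; ring
    rw [e2, ih (m+1)]
    have e3 : m+1+n+1 = m + (n+1)+1 := by ring
    rw [e3]
    have : (m:ℝ)+1 ≠ 0 := by positivity
    have h4 : ((m + (n+1)+1).factorial:ℝ) ≠ 0 := by positivity
    rw [Nat.factorial_succ m, Nat.factorial_succ n]
    push_cast
    field_simp
    simp

lemma coef_eq (a b c i : ℕ) (h : i ≤ b) :
    ((a+b+c+1).factorial : ℝ) / (a.factorial * b.factorial * c.factorial) *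
     (b.choose i * (((a+i).factorial * c.factorial : ℝ) / (a+i+c+1).factorial)) =
     (a+i).choose i * (a+b+c+1).choose (b-i) := by
  rw [Nat.cast_choose ℝ h, Nat.cast_choose ℝ (Nat.le_add_left i a),
    Nat.cast_choose ℝ (show b - i ≤ a+b+c+1 by omega)]
  have e1 : a+b+c+1-(b-i) = a+i+c+1 := by omega
  have e2 : a + i - i = a := by omega
  rw [e1, e2]
  have : ((a+i+c+1).factorial:ℝ) ≠ 0 := by positivity
  have : (i.factorial:ℝ) ≠ 0 := by positivity
  have : (a.factorial:ℝ) ≠ 0 := by positivity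
  have : (b.factorial:ℝ) ≠ 0 := by positivity
  have : (c.factorial:ℝ) ≠ 0 := by positivity
  have : ((b-i).factorial:ℝ) ≠ 0 := by positivity
  field_simp

lemma int_T (a b c : ℕ) (z : ℝ) :
   ((a+b+c+1).factorial : ℝ) / (a.factorial * b.factorial * c.factorial) *
     ∫ s in (0:ℝ)..1, s^a * (1-z*s)^b * (1-s)^c = aeval z (pT a b (a+b+c+1)) := by
  have e : ∀ s : ℝ, s^a * (1-z*s)^b * (1-s)^c = ∑ i ∈ Finset.range (b+1),
      ((-1)^i * b.choose i * z^i) * (s^(a+i) * (1-s)^c) := by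
    intro s
    have : (1 - z*s)^b = ∑ i ∈ Finset.range (b+1), (-(z*s))^i * b.choose i := by
      rw [sub_eq_add_neg, add_comm, add_pow]; simp
    rw [this, Finset.mul_sum, Finset.sum_mul]
    refine Finset.sum_congr rfl fun i _ => ?_
    rw [neg_pow, mul_pow, pow_add]; ring
  simp_rw [e]
  rw [intervalIntegral.integral_finsetSum
    (fun i _ => Continuous.intervalIntegrable (by fun_prop) _ _)]
  simp_rw [intervalIntegral.integral_const_mul, beta_nat]
  rw [pT, map_sum, Finset.mul_sum]
  refine Finset.sum_congr rfl fun i hi => ?_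
  have := coef_eq a b c i (by simp at hi; omega)
  simp only [map_mul, aeval_C, map_pow, aeval_X, map_neg, map_one]
  simp only [algebraMap_int_eq, eq_intCast, Int.cast_natCast]
  linear_combination ((-1)^i * z^i) * this

lemma int_P (a b c : ℕ) (z : ℝ) :
   ((a+b+c+1).factorial : ℝ) / (a.factorial * b.factorial * c.factorial) *
     ∫ s in (0:ℝ)..1, s^a * (1-s)^b * (z-s)^c = aeval z (pP a c (a+b+c+1)) := by
  have e : ∀ s : ℝ, s^a * (1-s)^b * (z-s)^c = ∑ i ∈ Finset.range (c+1),
      ((-1)^i * c.choose i * z^(c-i)) * (s^(a+i) * (1-s)^b) := by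
    intro s
    have : (z-s)^c = ∑ i ∈ Finset.range (c+1), (-s)^i * z^(c-i) * c.choose i := by
      rw [sub_eq_add_neg, add_comm, add_pow]
    rw [this, Finset.mul_sum]
    refine Finset.sum_congr rfl fun i _ => ?_
    rw [neg_pow, pow_add]; ring
  simp_rw [e]
  rw [intervalIntegral.integral_finsetSum
    (fun i _ => Continuous.intervalIntegrable (by fun_prop) _ _)]
  simp_rw [intervalIntegral.integral_const_mul, beta_nat]
  rw [pP, map_sum, Finset.mul_sum]
  refine Finset.sum_congr rfl fun i hi => ?_
  have := coef_eq a c b i (by simp at hi; omega)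
  rw [show a + c + b + 1 = a+b+c+1 by ring] at this
  simp only [map_mul, aeval_C, map_pow, aeval_X, map_neg, map_one]
  simp only [algebraMap_int_eq, eq_intCast, Int.cast_natCast]
  linear_combination ((-1)^i * z^(c-i)) * this

lemma pade_id_real (a b c : ℕ) (z : ℝ) :
   z^(a+c+1) * aeval z (pT a b (a+b+c+1)) +
    (-1)^c * (1-z)^(b+c+1) * aeval (1-z) (pT b a (a+b+c+1)) = aeval z (pP a c (a+b+c+1)) := by
  rw [← int_P, ← int_T, show a+b+c+1 = b+a+c+1 by ring, ← int_T]
  have h1 := intervalIntegral.smul_integral_comp_mul_left (a := 0) (b := 1)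
    (fun t : ℝ => t^a*(1-t)^b*(z-t)^c) z
  have h2 := intervalIntegral.smul_integral_comp_sub_mul (a := 0) (b := 1)
    (fun t : ℝ => t^a*(1-t)^b*(z-t)^c) (1-z) 1
  have h3 := intervalIntegral.integral_add_adjacent_intervals (a := 0) (b := z) (c := 1)
    (f := (fun t : ℝ => t^a*(1-t)^b*(z-t)^c)) (μ := MeasureTheory.volume)
    (Continuous.intervalIntegrable (by fun_prop) _ _) (Continuous.intervalIntegrable (by fun_prop) _ _)
  simp only [mul_zero, mul_one, sub_zero, sub_sub_cancel] at h1 h2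
  rw [← h3, ← h1, ← h2]
  simp only [smul_eq_mul]
  have e1 : ∀ s : ℝ, (z*s)^a*(1-z*s)^b*(z-z*s)^c = z^(a+c) * (s^a * (1-z*s)^b*(1-s)^c) := by
    intro s; rw [mul_pow, show z - z*s = z * (1-s) by ring, mul_pow, pow_add]; ring
  have e2 : ∀ s : ℝ, (1-(1-z)*s)^a*((1-z)*s)^b*(z-(1-(1-z)*s))^c =
      (-1)^c * (1-z)^(b+c) * (s^b * (1-(1-z)*s)^a*(1-s)^c) := by
    intro s; rw [mul_pow, show (z-(1-(1-z)*s)) = (-1) * ((1-z) * (1-s)) by ring, mul_pow, mul_pow,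
      pow_add]; ring
  simp_rw [e1, e2, intervalIntegral.integral_const_mul]
  ring

lemma pade_id (a b c : ℕ) :
   X^(a+c+1) * (pT a b (a+b+c+1)) +
    (-1)^c * (1-X)^(b+c+1) * (pT b a (a+b+c+1)).comp (1-X) = (pP a c (a+b+c+1)) := by
  apply Polynomial.map_injective (Int.castRingHom ℝ) Int.cast_injective
  apply Polynomial.funext
  intro z
  have := pade_id_real a b c z
  simp only [aeval_def, eval₂_eq_eval_map, algebraMap_int_eq] at this
  simp only [Polynomial.map_add, Polynomial.map_mul, Polynomial.map_pow, Polynomial.map_neg, Polynomial.map_one,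
    Polynomial.map_sub, Polynomial.map_X, Polynomial.map_comp, eval_add, eval_mul, eval_pow, eval_neg, eval_one, eval_sub, eval_X, eval_comp]
  exact this


lemma pT_natDegree (a b n : ℕ) : (pT a b n).natDegree ≤ b := by
  refine natDegree_sum_le_of_forall_le _ _ fun i hi => ?_
  refine (natDegree_C_mul_X_pow_le _ _).trans ?_
  simp at hi; omega

lemma pP_natDegree (a c n : ℕ) : (pP a c n).natDegree ≤ c := by
  refine natDegree_sum_le_of_forall_le _ _ fun i hi => ?_
  refine (natDegree_C_mul_X_pow_le _ _).trans ?_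
  omega

lemma pT_eval_zero (a b n : ℕ) : (pT a b n).eval 0 = n.choose b := by
  rw [pT, eval_finsetSum, Finset.sum_range_succ']
  simp

lemma pP_eval_zero (a c n : ℕ) : (pP a c n).eval 0 = (-1)^c * (a+c).choose c := by
  rw [pP, eval_finsetSum, Finset.sum_range_succ]
  simp
  refine Finset.sum_eq_zero fun i hi => ?_
  simp at hi
  have : c - i ≠ 0 := by omega
  simp [this]

lemma pT_eval_one (a b c : ℕ) : (pT b a (a+b+c+1)).eval 1 = (a+c).choose c := by
  have := congrArg (eval 0) (pade_id a b c)
  rw [pP_eval_zero] at this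
  simp [eval_comp] at this
  exact this

lemma sum_choose_le (a b n : ℕ) : ∑ i ∈ Finset.range (b+1), ((a+i).choose i * n.choose (b-i) : ℕ) ≤ 2^(a+b) * 2^n := by
  calc _ ≤ ∑ i ∈ Finset.range (b+1), 2^(a+b) * n.choose (b-i) := by
        refine Finset.sum_le_sum fun i hi => ?_
        simp at hi
        gcongr
        exact (Nat.choose_le_two_pow _ _).trans (Nat.pow_le_pow_right (by norm_num) (by omega))
    _ = 2^(a+b) * ∑ i ∈ Finset.range (b+1), n.choose i := by
        rw [← Finset.mul_sum, ← Finset.sum_range_reflect (fun i => n.choose i)]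
        simp
    _ ≤ 2^(a+b) * 2^n := by
        gcongr
        rw [← Nat.sum_range_choose]
        by_cases h : b ≤ n
        · exact Finset.sum_le_sum_of_subset (by simpa using h)
        · rw [← Finset.sum_subset (s₁ := Finset.range (n+1)) (s₂ := Finset.range (b+1))]
          · simp; omega
          · intro i _ hi; simp at hi; exact Nat.choose_eq_zero_of_lt (by omega)

lemma abv_natCast_le {K : Type*} [Field K] (v : AbsoluteValue K ℝ) (n : ℕ) : v (n : K) ≤ n := by
  induction n with
  | zero => simp
  | succ n ih => push_cast; exact (v.add_le _ _).trans (by simpa using ih)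

lemma abv_sum_le {K : Type*} [Field K] (v : AbsoluteValue K ℝ) (a b n : ℕ) (x : K) (e : ℕ → ℕ)
    (D : ℕ) (he : ∀ i ≤ b, e i ≤ D) (m : ℝ) (hm : 1 ≤ m) (hx : v x ≤ m) :
    v (∑ i ∈ Finset.range (b+1), (-1)^i * ((a+i).choose i : K) * (n.choose (b-i) : K) * x^(e i)) ≤
      2^(a+b) * 2^n * m^D := by
  calc _ ≤ ∑ i ∈ Finset.range (b+1), v ((-1)^i * ((a+i).choose i : K) * (n.choose (b-i) : K) * x^(e i)) := v.sum_le _ _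
    _ ≤ ∑ i ∈ Finset.range (b+1), (((a+i).choose i * n.choose (b-i) : ℕ) : ℝ) * m^D := by
        refine Finset.sum_le_sum fun i hi => ?_
        simp only [Finset.mem_range] at hi
        simp only [map_mul, map_pow, AbsoluteValue.map_neg, map_one, one_pow, one_mul, Nat.cast_mul]
        have h1 := abv_natCast_le v ((a+i).choose i)
        have h2 := abv_natCast_le v (n.choose (b-i))
        have h3 : v x ^ e i ≤ m^D := (pow_le_pow_left₀ (v.nonneg _) hx _).trans
          (pow_le_pow_right₀ hm (he i (by omega)))
        gcongr
    _ ≤ _ := by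
        rw [← Finset.sum_mul]
        gcongr
        exact_mod_cast sum_choose_le a b n

lemma abv_pT_le {K : Type*} [Field K] (v : AbsoluteValue K ℝ) (a b n : ℕ) (x : K) 
    (m : ℝ) (hm : 1 ≤ m) (hx : v x ≤ m) : v (aeval x (pT a b n)) ≤ 2^(a+b) * 2^n * m^b := by
  convert! abv_sum_le v a b n x (fun i => i) b (fun i h => h) m hm hx using 2
  simp [pT]

lemma abv_pP_le {K : Type*} [Field K] (v : AbsoluteValue K ℝ) (a b n : ℕ) (x : K) 
    (m : ℝ) (hm : 1 ≤ m) (hx : v x ≤ m) : v (aeval x (pP a b n)) ≤ 2^(a+b) * 2^n * m^b := by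
  convert! abv_sum_le v a b n x (fun i => b - i) b (fun i h => by omega) m hm hx using 2
  simp [pP]

lemma aeval_mem_subring {K : Type*} [Field K] (O : Subring K) (x : K) (hx : x ∈ O) (p : ℤ[X]) :
    aeval x p ∈ O := by
  rw [aeval_eq_sum_range]
  exact Subring.sum_mem _ fun i _ => by
    rw [zsmul_eq_mul]; exact O.mul_mem (intCast_mem O _) (O.pow_mem hx _)

/-- value-level good triple -/
def GoodTriple {K : Type*} [Field K] (N : ℕ) (x y E Q P : K) : Prop :=
  x^(2*N+1) * E + y^(2*N+1) * Q = P ∧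
  (∀ O : Subring K, x ∈ O → y ∈ O → E ∈ O ∧ Q ∈ O ∧ P ∈ O) ∧
  ∀ (v : AbsoluteValue K ℝ) (m : ℝ), 1 ≤ m → v x ≤ m → v y ≤ m →
    v E ≤ 64^(N+1) * m^(N+1) ∧ v Q ≤ 64^(N+1) * m^(N+1) ∧ v P ≤ 64^(N+1) * m^(N+1)

lemma bd_aux (A B N D : ℕ) (m : ℝ) (hm : 1 ≤ m) (h : A + B ≤ 6*(N+1)) (hD : D ≤ N+1) :
    2^A * 2^B * m^D ≤ 64^(N+1) * m^(N+1) := by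
  have : (64:ℝ)^(N+1) = 2^(6*(N+1)) := by rw [pow_mul]; norm_num
  rw [this, ← pow_add]
  gcongr
  · norm_num

lemma good_u {K : Type*} [Field K] (N : ℕ) (x y : K) (h : x + y = 1) :
    GoodTriple N x y (aeval x (pT N N (3*N+1))) ((-1)^N * aeval y (pT N N (3*N+1)))
      (aeval x (pP N N (3*N+1))) := by
  have hy : y = 1 - x := by rw [← h]; ring
  refine ⟨?_, ?_, ?_⟩
  · have := congrArg (aeval x) (pade_id N N N)
    simp only [map_add, map_mul, map_pow, map_neg, map_one, map_sub, aeval_X, aeval_comp] at this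
    rw [← hy] at this
    rw [show N+N+N+1 = 3*N+1 by ring, show N+N+1 = 2*N+1 by ring] at this
    rw [← this]; ring
  · intro O hx hy
    refine ⟨aeval_mem_subring _ _ hx _, O.mul_mem (O.pow_mem (O.neg_mem O.one_mem) _) (aeval_mem_subring _ _ hy _), aeval_mem_subring _ _ hx _⟩
  · intro v m hm hx hy
    refine ⟨(abv_pT_le v _ _ _ _ m hm hx).trans (bd_aux _ _ _ _ _ hm (by omega) (by omega)), ?_,
      (abv_pP_le v _ _ _ _ m hm hx).trans (bd_aux _ _ _ _ _ hm (by omega) (by omega))⟩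
    simp only [map_mul, map_pow, AbsoluteValue.map_neg, map_one, one_pow, one_mul]
    exact (abv_pT_le v _ _ _ _ m hm hy).trans (bd_aux _ _ _ _ _ hm (by omega) (by omega))

lemma good_v {K : Type*} [Field K] (N : ℕ) (x y : K) (h : x + y = 1) :
    GoodTriple N x y (x * aeval x (pT (N+1) N (3*N+2))) ((-1)^N * aeval y (pT N (N+1) (3*N+2)))
      (aeval x (pP (N+1) N (3*N+2))) := by
  have hy : y = 1 - x := by rw [← h]; ring
  refine ⟨?_, ?_, ?_⟩
  · have := congrArg (aeval x) (pade_id (N+1) N N)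
    simp only [map_add, map_mul, map_pow, map_neg, map_one, map_sub, aeval_X, aeval_comp] at this
    rw [← hy] at this
    rw [show N+1+N+N+1 = 3*N+2 by ring, show N+N+1 = 2*N+1 by ring, show N+1+N+1 = 2*N+1+1 by ring] at this
    rw [← this]; ring
  · intro O hx hy
    refine ⟨O.mul_mem hx (aeval_mem_subring _ _ hx _), O.mul_mem (O.pow_mem (O.neg_mem O.one_mem) _) (aeval_mem_subring _ _ hy _), aeval_mem_subring _ _ hx _⟩
  · intro v m hm hx hy
    refine ⟨?_, ?_,
      (abv_pP_le v _ _ _ _ m hm hx).trans (bd_aux _ _ _ _ _ hm (by omega) (by omega))⟩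
    · rw [map_mul]
      calc _ ≤ m * (2^(N+1+N) * 2^(3*N+2) * m^N) := by
            gcongr
            exact abv_pT_le v _ _ _ _ m hm hx
        _ = 2^(N+1+N) * 2^(3*N+2) * m^(N+1) := by ring
        _ ≤ _ := bd_aux _ _ _ _ _ hm (by omega) (by omega)
    simp only [map_mul, map_pow, AbsoluteValue.map_neg, map_one, one_pow, one_mul]
    exact (abv_pT_le v _ _ _ _ m hm hy).trans (bd_aux _ _ _ _ _ hm (by omega) (by omega))

lemma comp_natDegree (p : ℤ[X]) : (p.comp (1 - X)).natDegree ≤ p.natDegree := by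
  refine natDegree_comp_le.trans ?_
  have : (1 - X : ℤ[X]).natDegree ≤ 1 := by
    refine (natDegree_sub_le _ _).trans (by simp)
  nlinarith

lemma det_poly (N : ℕ) : ∃ d : ℤ, d ≠ 0 ∧
    pT N N (3*N+1) * ((pT N (N+1) (3*N+2)).comp (1-X)) -
      (X * pT (N+1) N (3*N+2)) * ((pT N N (3*N+1)).comp (1-X)) = C d := by
  set D := pT N N (3*N+1) * ((pT N (N+1) (3*N+2)).comp (1-X)) -
      (X * pT (N+1) N (3*N+2)) * ((pT N N (3*N+1)).comp (1-X)) with hD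
  have h1 := pade_id N N N
  have h2 := pade_id (N+1) N N
  rw [show N+N+N+1 = 3*N+1 by ring, show N+N+1 = 2*N+1 by ring] at h1
  rw [show N+1+N+N+1 = 3*N+2 by ring, show N+N+1 = 2*N+1 by ring, show N+1+N+1 = 2*N+1+1 by ring] at h2
  have key : X^(2*N+1) * D = pP N N (3*N+1) * ((pT N (N+1) (3*N+2)).comp (1-X)) -
     pP (N+1) N (3*N+2) * ((pT N N (3*N+1)).comp (1-X)) := by
    rw [← h1, ← h2, hD]; ring
  have h0 : D.eval 0 ≠ 0 := by
    have e := pT_eval_one (N+1) N N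
    rw [show N+1+N+N+1 = 3*N+2 by ring] at e
    rw [hD]
    simp only [eval_sub, eval_mul, eval_X, zero_mul, sub_zero, eval_comp, eval_one, pT_eval_zero, e]
    have a1 := Nat.choose_pos (show N ≤ 3*N+1 by omega)
    have a2 := Nat.choose_pos (show N ≤ N+1+N by omega)
    positivity
  have hD0 : D ≠ 0 := by rintro h; simp [h] at h0
  have hdeg : (X^(2*N+1) * D).natDegree ≤ 2*N+1 := by
    rw [key]
    refine (natDegree_sub_le _ _).trans (max_le ?_ ?_)
    · refine natDegree_mul_le.trans ?_
      have := pP_natDegree N N (3*N+1)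
      have := (comp_natDegree (pT N (N+1) (3*N+2))).trans (pT_natDegree _ _ _)
      omega
    · refine natDegree_mul_le.trans ?_
      have := pP_natDegree (N+1) N (3*N+2)
      have := (comp_natDegree (pT N N (3*N+1))).trans (pT_natDegree _ _ _)
      omega
  rw [natDegree_mul (by simp) hD0, natDegree_X_pow] at hdeg
  have : D = C (D.coeff 0) := eq_C_of_natDegree_eq_zero (by omega)
  refine ⟨D.coeff 0, ?_, this⟩
  rw [coeff_zero_eq_eval_zero]; exact h0

/-- For every `(a,b) ≠ 0` one of the two Padé triples is nondegenerate. -/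
lemma exists_goodTriple {K : Type*} [Field K] [CharZero K] (N : ℕ) (x y a b : K) (h : x + y = 1) (ha : a ≠ 0) :
    ∃ E Q P : K, GoodTriple N x y E Q P ∧ a * Q - b * E ≠ 0 := by
  by_contra! hc
  have h1 := hc _ _ _ (good_u N x y h)
  have h2 := hc _ _ _ (good_v N x y h)
  obtain ⟨d, hd, hD⟩ := det_poly N
  have := congrArg (aeval x) hD
  have hy : y = 1 - x := by rw [← h]; ring
  simp only [map_mul, map_one, map_sub, aeval_X, aeval_comp, aeval_C] at this
  rw [← hy] at this
  have h3 : a * ((-1)^N * ((algebraMap ℤ K) d)) = 0 := by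
    rw [← this]
    linear_combination (aeval x (pT N N (3*N+1))) * h2 - (x * aeval x (pT (N+1) N (3*N+2))) * h1
  simp [ha, hd] at h3


/-- The log-height of a pair with respect to a finite weighted family of absolute values. -/
noncomputable def hgt {K I : Type*} [Field K] [Fintype I] (v : I → AbsoluteValue K ℝ) (w : I → ℝ) (a b : K) : ℝ :=
  ∑ i, w i * Real.log (max 1 (max (v i a) (v i b)))

lemma gap_ineq {K I : Type*} [Field K] [CharZero K] [Fintype I] (v : I → AbsoluteValue K ℝ) (w : I → ℝ)
    (hw : ∀ i, 1 ≤ w i) (O : Subring K)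
    (h1 : ∀ κ ∈ O, κ ≠ 0 → 0 ≤ ∑ i, w i * Real.log (v i κ))
    (x y a b : K) (N : ℕ) (hxy : x + y = 1) (hx : x ∈ O) (hy : y ∈ O) (ha : a ∈ O) (hb : b ∈ O)
    (hx0 : x ≠ 0) (hy0 : y ≠ 0) (ha0 : a ≠ 0) (hab : a * x^(2*N+1) + b * y^(2*N+1) = 1) :
    N * hgt v w x y ≤ hgt v w a b + (∑ i, w i) * ((N+1) * Real.log 128) := by
  obtain ⟨E, Q, P, ⟨hid, hO, hbd⟩, hne⟩ := exists_goodTriple N x y a b hxy ha0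
  set κ := a * Q - b * E with hκ
  obtain ⟨hE, hQ, hP⟩ := hO O hx hy
  have hκO : κ ∈ O := O.sub_mem (O.mul_mem ha hQ) (O.mul_mem hb hE)
  have hk := h1 κ hκO hne
  have e1 : κ * x^(2*N+1) = Q - b * P := by
    rw [hκ, ← hid]; linear_combination Q * hab
  have e2 : κ * y^(2*N+1) = a * P - E := by
    rw [hκ, ← hid]; linear_combination -E * hab
  have key : ∀ i, Real.log (v i κ) + (2*N+1) * Real.log (max 1 (max (v i x) (v i y))) ≤
     (N+1) * Real.log 128 + (N+1) * Real.log (max 1 (max (v i x) (v i y))) +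
       Real.log (max 1 (max (v i a) (v i b))) := by
    intro i
    set m := max 1 (max (v i x) (v i y)) with hm
    set M := max 1 (max (v i a) (v i b)) with hM
    have hm1 : 1 ≤ m := le_max_left _ _
    have hM1 : 1 ≤ M := le_max_left _ _
    obtain ⟨bE, bQ, bP⟩ := hbd (v i) m hm1 (by simp [hm]) (by simp [hm])
    have aM : v i a ≤ M := by simp [hM]
    have bM : v i b ≤ M := by simp [hM]
    set B := (64:ℝ)^(N+1) * m^(N+1) with hB
    have hB0 : 0 ≤ B := by positivity
    have t : ∀ r s r' s' : K, v i r ≤ M → v i r' ≤ M → v i s ≤ B → v i s' ≤ B → v i (r * s - r' * s') ≤ 2 * M * B := by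
      intro r s r' s' h1 h2 h3 h4
      calc v i (r*s - r'*s') ≤ v i (r*s) + v i (r' * s') := by
            rw [sub_eq_add_neg]; refine ((v i).add_le _ _).trans ?_
            rw [(v i).map_neg]
        _ ≤ M * B + M * B := by
            rw [map_mul, map_mul]; gcongr
        _ = _ := by ring
    have o : v i 1 ≤ M := by simpa using hM1
    have b1 : v i κ ≤ 2 * M * B := t _ _ _ _ aM bM bQ bE
    have b2 : v i κ * (v i x)^(2*N+1) ≤ 2 * M * B := by
      rw [← map_pow, ← map_mul, e1]; simpa using t 1 Q b P o bM bQ bP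
    have b3 : v i κ * (v i y)^(2*N+1) ≤ 2 * M * B := by
      rw [← map_pow, ← map_mul, e2]; simpa using t a P 1 E aM o bP bE
    have b4 : v i κ * m^(2*N+1) ≤ 2 * M * B := by
      rcases max_choice 1 (max (v i x) (v i y)) with h | h
      · rw [hm, h]; simpa using b1
      · rcases max_choice (v i x) (v i y) with h' | h'
        · rw [hm, h, h']; exact b2
        · rw [hm, h, h']; exact b3
    have vκ : 0 < v i κ := (v i).pos hne
    have b5 : v i κ * m^(2*N+1) ≤ 128^(N+1) * m^(N+1) * M := by
      refine b4.trans ?_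
      have : (128:ℝ)^(N+1) = 2^(N+1) * 64^(N+1) := by rw [← mul_pow]; norm_num
      rw [this, hB]
      have : (2:ℝ) ≤ 2^(N+1) := by
        calc (2:ℝ) = 2^1 := by norm_num
          _ ≤ _ := pow_le_pow_right₀ (by norm_num) (by omega)
      calc 2 * M * (64^(N+1) * m^(N+1)) = 2 * (64^(N+1) * m^(N+1) * M) := by ring
        _ ≤ 2^(N+1) * (64^(N+1) * m^(N+1) * M) := by gcongr
        _ = _ := by ring
    have := Real.log_le_log (by positivity) b5
    rw [Real.log_mul (by positivity) (by positivity), Real.log_mul (by positivity) (by positivity),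
      Real.log_mul (by positivity) (by positivity), Real.log_pow, Real.log_pow, Real.log_pow] at this
    push_cast at this
    exact this
  have sum := Finset.sum_le_sum (s := Finset.univ) fun i _ =>
    mul_le_mul_of_nonneg_left (key i) (zero_le_one.trans (hw i))
  have s1 : ∑ i, w i * (Real.log (v i κ) + (2*N+1) * Real.log (max 1 (max (v i x) (v i y)))) =
     ∑ i, w i * Real.log (v i κ) + (2*N+1) * hgt v w x y := by
    rw [hgt, Finset.mul_sum, ← Finset.sum_add_distrib]
    exact Finset.sum_congr rfl fun i _ => by ring
  have s2 : ∑ i, w i * ((N+1) * Real.log 128 + (N+1) * Real.log (max 1 (max (v i x) (v i y))) +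
       Real.log (max 1 (max (v i a) (v i b)))) = (∑ i, w i) * ((N+1) * Real.log 128) + (N+1) * hgt v w x y + hgt v w a b := by
    rw [hgt, hgt, Finset.mul_sum, Finset.sum_mul, ← Finset.sum_add_distrib, ← Finset.sum_add_distrib]
    exact Finset.sum_congr rfl fun i _ => by ring
  rw [s1, s2] at sum
  linarith

/-- log vectors -/
noncomputable def lvec {K I : Type*} [Field K] (v : I → AbsoluteValue K ℝ) (x y : K) : I → ℝ × ℝ :=
  fun i => (Real.log (v i x), Real.log (v i y))

lemma log_max_le {s t r : ℝ} (hs : 0 < s) (ht : 0 < t) (hr : 0 ≤ r) (h1 : Real.log s ≤ r) (h2 : Real.log t ≤ r) :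
    Real.log (max 1 (max s t)) ≤ r := by
  rcases max_choice 1 (max s t) with h | h
  · rw [h]; simpa
  · rw [h]; rcases max_choice s t with h | h <;> rw [h] <;> assumption

lemma hgt_le {K I : Type*} [Field K] [Fintype I] (v : I → AbsoluteValue K ℝ) (w : I → ℝ)
    (hw : ∀ i, 1 ≤ w i) (a b : K) (ha : a ≠ 0) (hb : b ≠ 0) :
    hgt v w a b ≤ (∑ i, w i) * ‖lvec v a b‖ := by
  rw [hgt, Finset.sum_mul]
  refine Finset.sum_le_sum fun i _ => mul_le_mul_of_nonneg_left ?_ (zero_le_one.trans (hw i))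
  have h := norm_le_pi_norm (lvec v a b) i
  refine log_max_le ((v i).pos ha) ((v i).pos hb) (norm_nonneg _) ?_ ?_
  · exact (le_abs_self _).trans ((norm_fst_le (lvec v a b i)).trans h)
  · exact (le_abs_self _).trans ((norm_snd_le (lvec v a b i)).trans h)

lemma abs_log_le {K I : Type*} [Field K] [Fintype I] (v : I → AbsoluteValue K ℝ) (w : I → ℝ)
    (hw : ∀ i, 1 ≤ w i) (x y c : K) (hc : c = x ∨ c = y) (hc0 : c ≠ 0)
    (h1 : ∑ i, w i * Real.log (v i c) = 0) (i : I) :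
    |Real.log (v i c)| ≤ hgt v w x y := by
  classical
  have hle : ∀ j, w j * Real.log (v j c) ≤ w j * Real.log (max 1 (max (v j x) (v j y))) := by
    intro j
    refine mul_le_mul_of_nonneg_left (Real.log_le_log ((v j).pos hc0) ?_) (zero_le_one.trans (hw j))
    rcases hc with rfl | rfl <;> simp
  have hnn : ∀ j, 0 ≤ w j * Real.log (max 1 (max (v j x) (v j y))) := fun j =>
    mul_nonneg (zero_le_one.trans (hw j)) (Real.log_nonneg (le_max_left _ _))
  have hs : ∀ s : Finset I, ∑ j ∈ s, w j * Real.log (v j c) ≤ hgt v w x y := fun s =>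
    (Finset.sum_le_sum fun j _ => hle j).trans
      (Finset.sum_le_sum_of_subset_of_nonneg (Finset.subset_univ s) fun j _ _ => hnn j)
  have a1 := hs {i}
  have a2 := hs (Finset.univ.erase i)
  rw [← Finset.add_sum_erase _ _ (Finset.mem_univ i)] at h1
  rw [Finset.sum_singleton] at a1
  have : |w i * Real.log (v i c)| ≤ hgt v w x y := abs_le.mpr ⟨by linarith, a1⟩
  rw [abs_mul, abs_of_nonneg (zero_le_one.trans (hw i))] at this
  have := hw i
  have := abs_nonneg (Real.log (v i c))
  nlinarith

theorem unit_eq_finite {K I : Type*} [Field K] [CharZero K] [Fintype I] (v : I → AbsoluteValue K ℝ) (w : I → ℝ)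
    (hw : ∀ i, 1 ≤ w i) (O : Subring K)
    (h1 : ∀ κ ∈ O, κ ≠ 0 → 0 ≤ ∑ i, w i * Real.log (v i κ))
    (h2 : ∀ B : ℝ, {κ : K | κ ∈ O ∧ ∀ i, v i κ ≤ B}.Finite) :
    {u : K | u ≠ 0 ∧ 1 - u ≠ 0 ∧ u ∈ O ∧ u⁻¹ ∈ O ∧ 1 - u ∈ O ∧ (1-u)⁻¹ ∈ O}.Finite := by
  set U := {u : K | u ≠ 0 ∧ 1 - u ≠ 0 ∧ u ∈ O ∧ u⁻¹ ∈ O ∧ 1 - u ∈ O ∧ (1-u)⁻¹ ∈ O} with hU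
  by_contra hinf
  have hunit : ∀ c : K, c ≠ 0 → c ∈ O → c⁻¹ ∈ O → ∑ i, w i * Real.log (v i c) = 0 := by
    intro c hc h h'
    have a1 := h1 c h hc
    have a2 := h1 c⁻¹ h' (inv_ne_zero hc)
    simp only [map_inv₀, Real.log_inv, mul_neg, Finset.sum_neg_distrib] at a2
    linarith
  set L : K → (I → ℝ × ℝ) := fun u => lvec v u (1-u) with hL
  set W := ∑ i, w i with hWdef
  -- norms are bounded by heights
  have hnorm : ∀ u ∈ U, ‖L u‖ ≤ hgt v w u (1-u) := by
    rintro u ⟨a1, a2, a3, a4, a5, a6⟩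
    have hh : 0 ≤ hgt v w u (1-u) := Finset.sum_nonneg fun i _ =>
      mul_nonneg (zero_le_one.trans (hw i)) (Real.log_nonneg (le_max_left _ _))
    refine (pi_norm_le_iff_of_nonneg hh).mpr fun i => ?_
    refine norm_prod_le_iff.mpr ⟨?_, ?_⟩
    · exact abs_log_le v w hw u (1-u) u (Or.inl rfl) a1 (hunit u a1 a3 a4) i
    · exact abs_log_le v w hw u (1-u) (1-u) (Or.inr rfl) a2 (hunit _ a2 a5 a6) i
  have hbig : ∀ B : ℝ, {u ∈ U | ‖L u‖ ≤ B}.Finite := by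
    intro B
    refine (h2 (Real.exp B)).subset ?_
    rintro u ⟨⟨a1, a2, a3, a4, a5, a6⟩, hB⟩
    refine ⟨a3, fun i => ?_⟩
    have h := (norm_le_pi_norm (L u) i)
    have := (le_abs_self _).trans ((norm_fst_le (L u i)).trans (h.trans hB))
    exact (Real.log_le_iff_le_exp ((v i).pos a1)).mp this
  have hex : ∀ n : ℕ, ∃ u ∈ U, (n:ℝ) < ‖L u‖ := by
    intro n
    by_contra! hc
    exact hinf ((hbig n).subset fun u hu => ⟨hu, hc u hu⟩)
  choose s hsU hsn using hex
  have hbdd : ∀ n, (‖L (s n)‖⁻¹ • L (s n)) ∈ Metric.closedBall (0 : I → ℝ × ℝ) 1 := by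
    intro n
    rw [mem_closedBall_zero_iff, norm_smul, norm_inv, norm_norm]
    exact inv_mul_le_one
  obtain ⟨e, -, φ, hφ, hlim⟩ := (isCompact_closedBall (0 : I → ℝ × ℝ) 1).tendsto_subseq hbdd
  have hW0 : 0 ≤ W := Finset.sum_nonneg fun i _ => zero_le_one.trans (hw i)
  set ε : ℝ := 1 / (32 * (W+1)) with hε
  have hε0 : 0 < ε := by positivity
  obtain ⟨n0, hn0⟩ := Metric.tendsto_atTop.mp hlim ε hε0
  -- first solution
  have pick : ∀ B : ℝ, ∃ u ∈ U, B < ‖L u‖ ∧ 0 < ‖L u‖ ∧ ‖‖L u‖⁻¹ • L u - e‖ < ε := by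
    intro B
    obtain ⟨k, hk⟩ := exists_nat_gt B
    refine ⟨s (φ (max n0 k)), hsU _, ?_, ?_, ?_⟩
    · refine lt_trans ?_ (hsn _)
      refine hk.trans_le ?_
      exact_mod_cast (le_max_right n0 k).trans (hφ.id_le _)
    · exact (Nat.cast_nonneg _).trans_lt (hsn _)
    · have := hn0 (max n0 k) (le_max_left _ _)
      rwa [dist_eq_norm] at this
  set c0 := Real.log 128 with hc0
  have hc00 : 0 ≤ c0 := Real.log_nonneg (by norm_num)
  obtain ⟨u, huU, hut, hu0, hue⟩ := pick (8 * W * c0)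
  set t := ‖L u‖ with ht
  obtain ⟨X, hXU, hXT, hX0, hXe⟩ := pick ((2 * (4 * W + 1) + 2) * t)
  set T := ‖L X‖ with hT
  set N := ⌊T / (2*t)⌋₊ with hN
  have hN1 : (N:ℝ) * (2*t) ≤ T := by
    have := Nat.floor_le (show 0 ≤ T / (2*t) by positivity)
    rwa [le_div_iff₀ (by positivity)] at this
  have hN2 : T < (N + 1 : ℝ) * (2*t) := by
    have := Nat.lt_floor_add_one (T / (2*t))
    rwa [div_lt_iff₀ (by positivity)] at this
  have hN3 : 4 * W + 1 ≤ N := by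
    have : (2 * (4 * W + 1) + 2) * t < (N + 1 : ℝ) * (2*t) := hXT.trans hN2
    have : (2 * (4 * W + 1) + 2) * t < (2 * (N:ℝ) + 2) * t := by linarith
    have := lt_of_mul_lt_mul_right this hu0.le
    linarith
  obtain ⟨a1, a2, a3, a4, a5, a6⟩ := huU
  obtain ⟨b1, b2, b3, b4, b5, b6⟩ := hXU
  set k := 2*N+1 with hk
  set a := X * (u⁻¹)^k with ha
  set b := (1-X) * ((1-u)⁻¹)^k with hb
  have ha0 : a ≠ 0 := mul_ne_zero b1 (pow_ne_zero _ (inv_ne_zero a1))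
  have hb0 : b ≠ 0 := mul_ne_zero b2 (pow_ne_zero _ (inv_ne_zero a2))
  have ea : a * u^k = X := by rw [ha, inv_pow]; field_simp
  have eb : b * (1-u)^k = 1 - X := by rw [hb, inv_pow]; field_simp
  have gap := gap_ineq v w hw O h1 u (1-u) a b N (by ring) a3 a5 (O.mul_mem b3 (O.pow_mem a4 _))
    (O.mul_mem b5 (O.pow_mem a6 _)) a1 a2 ha0 (by rw [← hk, ea, eb]; ring)
  have hlv : lvec v a b = L X - (k:ℝ) • L u := by
    ext i
    · simp only [lvec, hL, ha, Pi.sub_apply, Pi.smul_apply, Prod.fst_sub, Prod.smul_fst, smul_eq_mul]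
      rw [map_mul, map_pow, map_inv₀, Real.log_mul (((v i).pos b1).ne') (pow_ne_zero _ (inv_ne_zero ((v i).pos a1).ne')),
        Real.log_pow, Real.log_inv]; ring
    · simp only [lvec, hL, hb, Pi.sub_apply, Pi.smul_apply, Prod.snd_sub, Prod.smul_snd, smul_eq_mul]
      rw [map_mul, map_pow, map_inv₀, Real.log_mul (((v i).pos b2).ne') (pow_ne_zero _ (inv_ne_zero ((v i).pos a2).ne')),
        Real.log_pow, Real.log_inv]; ring
  have hkr : (k:ℝ) = 2*N+1 := by rw [hk]; push_cast; ring
  have hnl : ‖lvec v a b‖ ≤ 2 * ε * T + t := by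
    have dec : L X - (k:ℝ) • L u = T • ((T⁻¹ • L X - e) - (t⁻¹ • L u - e)) + (T - k * t) • (t⁻¹ • L u) := by
      simp only [smul_sub, smul_smul, mul_inv_cancel₀ hX0.ne', one_smul]
      rw [show (T - (k:ℝ)*t)*t⁻¹ = T*t⁻¹ - k by field_simp, sub_smul]
      abel
    rw [hlv, dec]
    refine (norm_add_le _ _).trans ?_
    rw [norm_smul, norm_smul]
    have n1 : ‖t⁻¹ • L u‖ = 1 := by
      rw [norm_smul, norm_inv, norm_norm]; exact inv_mul_cancel₀ hu0.ne'
    have n2 : ‖T‖ = T := norm_norm _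
    have n3 : ‖(T - k * t)‖ ≤ t := by
      rw [Real.norm_eq_abs, abs_le, hkr]; constructor <;> nlinarith
    have n4 : ‖(T⁻¹ • L X - e) - (t⁻¹ • L u - e)‖ ≤ 2 * ε := (norm_sub_le _ _).trans (by linarith)
    rw [n1, n2, mul_one]
    nlinarith
  have hh := (hgt_le v w hw a b ha0 hb0).trans (mul_le_mul_of_nonneg_left hnl hW0)
  have hht := hnorm u ⟨a1, a2, a3, a4, a5, a6⟩
  have hNpos : (1:ℝ) ≤ N := by linarith
  have g1 : (N:ℝ) * t ≤ N * hgt v w u (1-u) := by gcongr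
  -- W * 2ε T ≤ (N+1) t / 8
  have g2 : W * (2 * ε * T) ≤ N * t / 4 := by
    have : W * ε ≤ 1/32 := by
      rw [hε, mul_one_div, div_le_div_iff₀ (by positivity) (by norm_num)]; linarith
    calc W * (2*ε*T) = (W*ε) * (2*T) := by ring
      _ ≤ 1/32 * (2*T) := by gcongr
      _ ≤ 1/32 * (2*((N + 1 : ℝ) * (2*t))) := by gcongr
      _ ≤ N * t / 4 := by nlinarith
  have g3 : W * t ≤ N * t / 4 := by nlinarith
  have g4 : W * ((N+1) * c0) ≤ N * t / 4 := by
    have : W * ((N+1) * c0) ≤ W * ((2*N) * c0) := by gcongr; linarith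
    nlinarith
  have g5 : 0 < N * t := by positivity
  nlinarith


section part3
open NumberField

/-- S-integers -/
def sInt (K : Type*) [Field K] [NumberField K] (T : Finset (FinitePlace K)) : Subring K where
  carrier := {x | ∀ v : FinitePlace K, v ∉ T → v x ≤ 1}
  mul_mem' := by
    intro a b ha hb v hv
    rw [map_mul]; exact mul_le_one₀ (ha v hv) (apply_nonneg _ _) (hb v hv)
  one_mem' := by intro v _; rw [map_one]
  add_mem' := by
    intro a b ha hb v hv
    exact (FinitePlace.add_le v a b).trans (max_le (ha v hv) (hb v hv))
  zero_mem' := by intro v _; rw [map_zero]; exact zero_le_one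
  neg_mem' := by
    intro a ha v hv
    have := ha v hv
    have h2 : v (-a) = v a := by
      have := (v.1).map_neg a
      exact this
    rw [h2]; exact this

lemma mem_sInt {K : Type*} [Field K] [NumberField K] {T : Finset (FinitePlace K)} {x : K} :
    x ∈ sInt K T ↔ ∀ v : FinitePlace K, v ∉ T → v x ≤ 1 := Iff.rfl

theorem sunit_finite (K : Type*) [Field K] [NumberField K] (T : Finset (FinitePlace K)) :
    {u : K | u ≠ 0 ∧ 1 - u ≠ 0 ∧ u ∈ sInt K T ∧ u⁻¹ ∈ sInt K T ∧
      1 - u ∈ sInt K T ∧ (1-u)⁻¹ ∈ sInt K T}.Finite := by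
  classical
  have hval : ∀ (v : FinitePlace K) (x : K), v.1 x = v x := fun _ _ => rfl
  have hval2 : ∀ (v : InfinitePlace K) (x : K), v.1 x = v x := fun _ _ => rfl
  refine unit_eq_finite (I := InfinitePlace K ⊕ T)
    (Sum.elim (fun v => v.1) (fun v => v.1.1)) (Sum.elim (fun v => (v.mult : ℝ)) (fun _ => 1)) ?_ _ ?_ ?_
  · rintro (i | i)
    · simp only [Sum.elim_inl]; exact_mod_cast InfinitePlace.mult_pos
    · simp
  · intro κ hκ h0
    rw [Fintype.sum_sum_type]
    simp only [Sum.elim_inl, Sum.elim_inr, one_mul, hval, hval2]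
    have hfin : (Function.mulSupport fun v : FinitePlace K => v κ).Finite :=
      FinitePlace.hasFiniteMulSupport h0
    have hpf := prod_abs_eq_one h0
    rw [finprod_eq_prod_of_mulSupport_subset (s := (hfin.toFinset \ T) ∪ T) _ (by
      intro v hv; simp only [Finset.coe_union, Finset.coe_sdiff, Set.Finite.coe_toFinset]; 
      by_cases h : v ∈ T
      · right; exact h
      · left; exact ⟨hv, h⟩), Finset.prod_union Finset.sdiff_disjoint] at hpf
    have hpos : ∀ v : FinitePlace K, 0 < v κ := fun v => FinitePlace.pos_iff.2 h0
    have hpos2 : ∀ v : InfinitePlace K, 0 < v κ := fun v => InfinitePlace.pos_iff.2 h0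
    have h1 : ∏ v ∈ hfin.toFinset \ T, v κ ≤ 1 := by
      refine Finset.prod_le_one (fun v _ => (hpos v).le) (fun v hv => hκ v (Finset.mem_sdiff.1 hv).2)
    have hp1 : 0 < ∏ w : InfinitePlace K, w κ ^ w.mult := Finset.prod_pos (fun v _ => pow_pos (hpos2 v) _)
    have hp2 : 0 < ∏ v ∈ T, v κ := Finset.prod_pos (fun v _ => hpos v)
    have h2 : 1 ≤ (∏ w : InfinitePlace K, w κ ^ w.mult) * ∏ v ∈ T, v κ := by
      rw [← hpf]
      gcongr
      exact mul_le_of_le_one_left hp2.le h1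
    have h3 := Real.log_nonneg h2
    rw [Real.log_mul hp1.ne' hp2.ne', Real.log_prod (fun v _ => (pow_pos (hpos2 v) _).ne'),
      Real.log_prod (fun v _ => (hpos v).ne')] at h3
    simp only [Real.log_pow] at h3
    rw [← Finset.sum_coe_sort T] at h3
    exact h3
  · intro B
    set B' := max B 1 with hB'
    refine (finite_setOfPred_mulHeight₁_le K
      ((∏ v : InfinitePlace K, B' ^ v.mult) * ∏ v ∈ T, B')).subset ?_
    rintro κ ⟨hκ, hb⟩
    show Height.mulHeight₁ κ ≤ _
    rw [mulHeight₁_eq, finprod_eq_prod_of_mulSupport_subset (s := T) _ (by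
      intro v hv
      by_contra h
      exact hv (max_eq_right (hκ v h)))]
    have e1 : ∀ v : InfinitePlace K, max (v κ) 1 ≤ B' := fun v =>
      max_le_max (hb (Sum.inl v)) le_rfl
    have e2 : ∀ v ∈ T, max (v κ) 1 ≤ B' := fun v hv =>
      max_le_max (hb (Sum.inr ⟨v, hv⟩)) le_rfl
    refine mul_le_mul ?_ ?_ ?_ ?_
    · exact Finset.prod_le_prod (fun v _ => by positivity) (fun v _ => by gcongr; exact e1 v)
    · exact Finset.prod_le_prod (fun v _ => by positivity) (fun v hv => e2 v hv)
    · exact Finset.prod_nonneg (fun v _ => by positivity)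
    · exact Finset.prod_nonneg (fun v _ => by positivity)

/-- finitely generated version -/
theorem fg_unit_finite (K : Type*) [Field K] [NumberField K] (s : Set K) (hs : s.Finite) :
    {u : K | u ≠ 0 ∧ 1 - u ≠ 0 ∧ IsIntegral (Subring.closure s) u ∧
      IsIntegral (Subring.closure s) u⁻¹ ∧ IsIntegral (Subring.closure s) (1 - u) ∧
      IsIntegral (Subring.closure s) (1 - u)⁻¹}.Finite := by
  classical
  have hT : (⋃ x ∈ s, {v : FinitePlace K | 1 < v x}).Finite := by
    refine hs.biUnion (fun x _ => ?_)
    by_cases h0 : x = 0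
    · subst h0
      convert Set.finite_empty
      ext v; simp
      
    · refine (FinitePlace.hasFiniteMulSupport h0).subset ?_
      intro v hv
      exact (ne_of_gt hv)
  set T := hT.toFinset with hTd
  have hcl : Subring.closure s ≤ sInt K T := by
    rw [Subring.closure_le]
    intro x hx v hv
    by_contra hc
    exact hv (by rw [hTd, Set.Finite.mem_toFinset]; exact Set.mem_biUnion hx (not_le.1 hc))
  have key : ∀ x : K, IsIntegral (Subring.closure s) x → x ∈ sInt K T := by
    rintro x ⟨p, hp, hpx⟩ v hv
    by_contra hc
    push Not at hc
    have hx : x ^ p.natDegree = - ∑ i ∈ Finset.range p.natDegree, (p.coeff i : K) * x^i := by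
      rw [eval₂_eq_sum_range, Finset.sum_range_succ, hp.coeff_natDegree, map_one, one_mul] at hpx
      rw [eq_neg_iff_add_eq_zero, add_comm]; exact hpx
    have hn : p.natDegree ≠ 0 := by
      intro h0
      rw [h0] at hx
      simp at hx
    have hle : ∀ n : ℕ, v.1 (∑ i ∈ Finset.range (n+1), (p.coeff i : K) * x^i) ≤ v x ^ n := by
      intro n
      induction n with
      | zero =>
        simp only [zero_add, Finset.range_one, Finset.sum_singleton, pow_zero, mul_one]
        exact hcl (p.coeff 0).2 v hv
      | succ n ih =>
        rw [Finset.sum_range_succ]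
        refine (FinitePlace.add_le v _ _).trans (max_le (ih.trans ?_) ?_)
        · exact pow_le_pow_right₀ hc.le (Nat.le_succ n)
        · have h1 : v (p.coeff (n+1) : K) ≤ 1 := hcl (p.coeff (n+1)).2 v hv
          calc v ((p.coeff (n+1) : K) * x^(n+1)) = v (p.coeff (n+1) : K) * v x^(n+1) := by
                rw [map_mul, map_pow]
            _ ≤ 1 * v x^(n+1) := by gcongr
            _ = _ := one_mul _
    obtain ⟨n, hn⟩ := Nat.exists_eq_succ_of_ne_zero hn
    have h2 : v x ^ (n+1) ≤ v x ^ n := by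
      have h3 : v.1 (x^p.natDegree) = v x ^ p.natDegree := map_pow v x _
      rw [hx, (v.1).map_neg, hn] at h3
      rw [← h3]
      exact hle n
    exact absurd h2 (not_le.2 (pow_lt_pow_right₀ hc (Nat.lt_succ_self n)))
  refine (sunit_finite K T).subset ?_
  rintro u ⟨h1, h2, h3, h4, h5, h6⟩
  exact ⟨h1, h2, key _ h3, key _ h4, key _ h5, key _ h6⟩

end part3


section part4
open NumberField

lemma mem_valuationSubring_of_integral {L : Type*} [Field L] (V : ValuationSubring L) (A : Subring L)
    (hA : A ≤ V.toSubring) {z : L} (hz : IsIntegral A z) : z ∈ V := by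
  have h1 : IsIntegral V.toSubring z :=
    IsIntegral.map_of_comp_eq (R := A) (T := V.toSubring) (S := L) (U := L)
      (Subring.inclusion hA) (RingHom.id L) rfl hz
  exact LocalSubring.mem_of_isMax_of_isIntegral V.isMax_toLocalSubring h1

/-- existence of a good place of `ℂ` -/
lemma exists_place (s : Set ℂ) (hs : s.Finite) (α : ℂ) (hα : ∀ n : ℕ, 1 ≤ n → α ^ n ≠ 1) :
    ∃ V : ValuationSubring ℂ, s ⊆ V ∧ (∀ q : ℚ, (q : ℂ) ∈ V) ∧
      (∀ (hαV : α ∈ V) (n : ℕ), 1 ≤ n → IsLocalRing.residue V ⟨α, hαV⟩ ^ n ≠ 1) ∧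
      ∃ (ρ : ℚ →+* IsLocalRing.ResidueField V),
        ∀ (x : ℂ) (hx : x ∈ V), x ∈ s → ρ.IsIntegralElem (IsLocalRing.residue V ⟨x, hx⟩) := by
  classical
  have hbasis : ∃ B : Set ℂ, IsTranscendenceBasis ℚ (Subtype.val : B → ℂ) ∧
      ∃ e : MvPolynomial B ℚ, e ≠ 0 ∧ (IsAlgebraic ℚ α ∨ ∃ i : B, i.1 = α ∧
        e = MvPolynomial.X i * (MvPolynomial.X i - 1) * (MvPolynomial.X i + 1)) := by
    by_cases halg : IsAlgebraic ℚ α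
    · obtain ⟨B, -, hB⟩ := exists_isTranscendenceBasis_superset (R := ℚ) (A := ℂ) (s := ∅)
        (by exact algebraicIndependent_empty_type)
      exact ⟨B, hB, 1, one_ne_zero, Or.inl halg⟩
    · obtain ⟨B, hsub, hB⟩ := exists_isTranscendenceBasis_superset (R := ℚ) (A := ℂ) (s := {α})
        (by
          refine (algebraicIndependent_singleton_iff (⟨α, rfl⟩ : ({α} : Set ℂ))).2 ?_
          exact halg)
      refine ⟨B, hB, _, ?_, Or.inr ⟨⟨α, hsub rfl⟩, rfl, rfl⟩⟩
      intro h
      have := congrArg (MvPolynomial.eval (fun _ => (2:ℚ))) h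
      simp at this
      norm_num at this
  obtain ⟨B, hB, e, he, hcond⟩ := hbasis
  have halg := hB.isAlgebraic
  set A0 := Algebra.adjoin ℚ (Set.range (Subtype.val : B → ℂ)) with hA0
  have hy : ∀ x : ℂ, ∃ y : A0, y ≠ 0 ∧ IsIntegral A0 (y • x) := fun x => by
    obtain ⟨y, h1, h2⟩ := (halg.isAlgebraic x).exists_integral_multiple
    exact ⟨y, h1, h2⟩
  choose y hy0 hyi using hy
  let E := hB.1.aevalEquiv
  have hne : e * ∏ x ∈ hs.toFinset, E.symm (y x) ≠ 0 := by
    refine mul_ne_zero he (Finset.prod_ne_zero_iff.2 (fun x _ => ?_))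
    rw [Ne, EmbeddingLike.map_eq_zero_iff]
    exact hy0 x
  obtain ⟨a, ha⟩ : ∃ a : B → ℚ, MvPolynomial.eval a (e * ∏ x ∈ hs.toFinset, E.symm (y x)) ≠ 0 := by
    by_contra hc
    push Not at hc
    exact hne (MvPolynomial.funext (fun x => by rw [hc x, map_zero]))
  rw [map_mul, map_prod] at ha
  have ha1 : MvPolynomial.eval a e ≠ 0 := left_ne_zero_of_mul ha
  have ha2 : ∀ x ∈ s, MvPolynomial.eval a (E.symm (y x)) ≠ 0 := fun x hx =>
    Finset.prod_ne_zero_iff.1 (right_ne_zero_of_mul ha) x (hs.mem_toFinset.2 hx)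
  let ψ : A0 →+* ℚ := (MvPolynomial.eval a).comp (E.symm : A0 →+* MvPolynomial B ℚ)
  let I : Ideal A0.toSubring := RingHom.ker ψ
  obtain ⟨V, hAV, hIV⟩ := Ideal.image_subset_nonunits_valuationSubring (A := A0.toSubring) I
    (RingHom.ker_ne_top ψ)
  have hqA : ∀ q : ℚ, (q:ℂ) ∈ A0 := fun q => by
    have := A0.algebraMap_mem q
    simpa using this
  have hqV : ∀ q : ℚ, (q:ℂ) ∈ V := fun q => hAV (hqA q)
  let ι : A0 →+* V := Subring.inclusion hAV
  let φ := IsLocalRing.residue V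
  let ρ : ℚ →+* IsLocalRing.ResidueField V := (φ.comp ι).comp (algebraMap ℚ A0)
  have hres : ∀ t : A0, φ (ι t) = ρ (ψ t) := by
    intro t
    have h1 : t - algebraMap ℚ A0 (ψ t) ∈ RingHom.ker ψ := by
      rw [RingHom.mem_ker, map_sub, sub_eq_zero]
      show ψ t = MvPolynomial.eval a (E.symm (algebraMap ℚ A0 (ψ t)))
      rw [AlgEquiv.commutes, MvPolynomial.algebraMap_eq, MvPolynomial.eval_C]
    have h2 : ((t - algebraMap ℚ A0 (ψ t) : A0) : ℂ) ∈ V.nonunits := hIV ⟨_, h1, rfl⟩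
    have h3 : φ (ι (t - algebraMap ℚ A0 (ψ t))) = 0 := by
      rw [IsLocalRing.residue_eq_zero_iff]
      rw [← SetLike.mem_coe, ← V.image_maximalIdeal] at h2
      obtain ⟨w, hw, hwe⟩ := h2
      have : w = ι (t - algebraMap ℚ A0 (ψ t)) := Subtype.ext hwe
      rw [← this]; exact hw
    rw [map_sub, map_sub, sub_eq_zero] at h3
    exact h3
  have hyu : ∀ x ∈ s, IsUnit (ι (y x)) := by
    intro x hx
    rw [← IsLocalRing.residue_ne_zero_iff_isUnit]
    show φ (ι (y x)) ≠ 0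
    rw [hres, _root_.map_ne_zero]
    exact ha2 x hx
  have hyx : ∀ x, (y x : ℂ) * x ∈ V := fun x => by
    refine mem_valuationSubring_of_integral V A0.toSubring hAV (hyi x)
  have hsV : ∀ x ∈ s, x ∈ V := by
    intro x hx
    obtain ⟨w, hw⟩ := (hyu x hx).exists_left_inv
    have hw' : (w:ℂ) * (y x) = 1 := congrArg Subtype.val hw
    have : x = (w:ℂ) * ((y x : ℂ) * x) := by rw [← mul_assoc, hw', one_mul]
    rw [this]
    exact V.mul_mem _ _ w.2 (hyx x)
  refine ⟨V, hsV, hqV, ?_, ρ, ?_⟩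
  · intro hαV n hn heq
    rcases hcond with h | ⟨i, hi, rfl⟩
    · -- algebraic case
      have h1 : IsAlgebraic ℚ (α^n - 1) := (h.pow n).sub isAlgebraic_one
      have h2 : IsIntegral ℚ (α^n - 1)⁻¹ := (h1.inv).isIntegral
      have h3 : (α^n-1)⁻¹ ∈ V := by
        refine mem_valuationSubring_of_integral V A0.toSubring hAV ?_
        exact h2.tower_top (A := A0)
      have h4 : (⟨α, hαV⟩ : V)^n - 1 ≠ 0 := fun h0 => by
        have := congrArg Subtype.val h0
        exact hα n hn (sub_eq_zero.1 this)
      have h5 : IsUnit ((⟨α, hαV⟩ : V)^n - 1) := by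
        refine IsUnit.of_mul_eq_one ⟨_, h3⟩ (Subtype.ext ?_)
        exact mul_inv_cancel₀ (sub_ne_zero.2 (hα n hn))
      rw [← IsLocalRing.residue_ne_zero_iff_isUnit] at h5
      apply h5
      rw [map_sub, map_pow, heq, map_one, sub_self]
    · have hmem : α ∈ A0 := hi ▸ Algebra.subset_adjoin ⟨i, rfl⟩
      have h1 : ψ ⟨α, hmem⟩ = a i := by
        have : E.symm ⟨α, hmem⟩ = MvPolynomial.X i := by
          rw [AlgEquiv.symm_apply_eq]
          refine Subtype.ext ?_
          rw [hB.1.aevalEquiv_apply_coe, MvPolynomial.aeval_X, hi]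
        show MvPolynomial.eval a (E.symm ⟨α, hmem⟩) = a i
        rw [this, MvPolynomial.eval_X]
      have h2 := hres ⟨α, hmem⟩
      have h3 : φ ⟨α, hαV⟩ = ρ (a i) := by rw [← h1, ← h2]; rfl
      have h4 : ρ (a i ^ n) = ρ 1 := by rw [map_pow, ← h3, map_one]; exact heq
      have h5 := ρ.injective h4
      simp only [map_mul, map_sub, map_add, MvPolynomial.eval_X, map_one] at ha1
      have h6 := (pow_eq_one_iff_cases.1 h5)
      rcases h6 with h6 | h6 | h6
      · omega
      · apply ha1; rw [h6]; ring
      · apply ha1; rw [h6.1]; ring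
  · intro x hx hxs
    -- `y x * x` integral
    let _ : Algebra A0 V := ι.toAlgebra
    let _ : Algebra ℚ (IsLocalRing.ResidueField V) := ρ.toAlgebra
    have h1 : IsIntegral A0 (⟨_, hyx x⟩ : V) := by
      obtain ⟨p, hp, hpx⟩ := hyi x
      refine ⟨p, hp, Subtype.ext ?_⟩
      have : ((eval₂ (algebraMap A0 V) (⟨_, hyx x⟩ : V) p : V) : ℂ)
        = eval₂ (algebraMap A0 ℂ) ((y x : ℂ) * x) p := by
        have := Polynomial.hom_eval₂ p (algebraMap A0 V) V.subtype (⟨_, hyx x⟩ : V)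
        exact this
      rw [this]; exact hpx
    have h2 : IsIntegral ℚ (φ ⟨_, hyx x⟩) := h1.map_of_comp_eq ψ φ (by
      ext t; exact (hres t).symm)
    have h3 : φ ⟨_, hyx x⟩ = algebraMap ℚ _ (ψ (y x)) * φ ⟨x, hx⟩ := by
      have : (⟨_, hyx x⟩ : V) = ι (y x) * ⟨x, hx⟩ := rfl
      rw [this, map_mul, hres]; rfl
    have h4 : φ ⟨x, hx⟩ = algebraMap ℚ _ (ψ (y x))⁻¹ * φ ⟨_, hyx x⟩ := by
      rw [h3, ← mul_assoc, ← map_mul, inv_mul_cancel₀ (show ψ (y x) ≠ 0 from ha2 x hxs), map_one, one_mul]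
    show IsIntegral ℚ (φ ⟨x, hx⟩)
    rw [h4]
    exact isIntegral_algebraMap.mul h2


lemma subring_closure_coe_preimage {R : Type*} [Ring R] (s : Set R) :
    Subring.closure ((Subtype.val : Subring.closure s → R) ⁻¹' s) = ⊤ := by
  refine top_unique ?_
  rintro ⟨z, hz⟩ -
  induction hz using Subring.closure_induction with
  | mem x hx => exact Subring.subset_closure hx
  | zero => exact Subring.zero_mem _
  | one => exact Subring.one_mem _
  | add x y hx hy h1 h2 => exact Subring.add_mem _ h1 h2
  | neg x hx h1 => exact Subring.neg_mem _ h1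
  | mul x y hx hy h1 h2 => exact Subring.mul_mem _ h1 h2

/-- the specialisation theorem -/
theorem specialization (s : Set ℂ) (hs : s.Finite) (α : ℂ) (hα : ∀ n : ℕ, 1 ≤ n → α ^ n ≠ 1) :
    ∃ V : ValuationSubring ℂ, Subring.closure s ≤ V.toSubring ∧
      (∀ (hαV : α ∈ V) (n : ℕ), 1 ≤ n → IsLocalRing.residue V ⟨α, hαV⟩ ^ n ≠ 1) ∧
      ∃ K0 : Subfield (IsLocalRing.ResidueField V),
        (∀ z : V, (z : ℂ) ∈ Subring.closure s → IsLocalRing.residue V z ∈ K0) ∧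
        {w | w ∈ K0 ∧ ∃ u : V, IsLocalRing.residue V u = w ∧ (u : ℂ) ≠ 0 ∧ 1 - (u : ℂ) ≠ 0 ∧
          IsIntegral (Subring.closure s) (u : ℂ) ∧ IsIntegral (Subring.closure s) (u : ℂ)⁻¹ ∧
          IsIntegral (Subring.closure s) (1 - (u : ℂ)) ∧
          IsIntegral (Subring.closure s) (1 - (u : ℂ))⁻¹}.Finite := by
  classical
  obtain ⟨V, hsV, hqV, h1, ρ, hρ⟩ := exists_place s hs α hα
  have hcl : Subring.closure s ≤ V.toSubring := Subring.closure_le.2 hsV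
  let κ := IsLocalRing.ResidueField V
  let φ : V →+* κ := IsLocalRing.residue V
  have : CharZero κ := charZero_of_injective_ringHom ρ.injective
  have hρa : ρ = algebraMap ℚ κ := Subsingleton.elim _ _
  let sV : Set V := Subtype.val ⁻¹' s
  have hsVf : sV.Finite := hs.preimage Subtype.val_injective.injOn
  let sφ : Set κ := Set.image φ sV
  have hsφ : sφ.Finite := hsVf.image _
  let K := IntermediateField.adjoin ℚ sφ
  have : Finite sφ := hsφ
  have hfd : FiniteDimensional ℚ K := IntermediateField.finiteDimensional_adjoin (by
    rintro _ ⟨x, hx, rfl⟩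
    have := hρ x.1 x.2 hx
    rw [hρa] at this
    exact this)
  have : NumberField K := { }
  let s' : Set K := Subtype.val ⁻¹' sφ
  have hs' : s'.Finite := hsφ.preimage Subtype.val_injective.injOn
  let ι : Subring.closure s →+* V := Subring.inclusion hcl
  have hgen : Subring.closure ((Subtype.val : Subring.closure s → ℂ) ⁻¹' s) = ⊤ :=
    subring_closure_coe_preimage s
  have hθ0 : ∀ z : Subring.closure s, φ (ι z) ∈ K := by
    have : Subring.closure ((Subtype.val : Subring.closure s → ℂ) ⁻¹' s) ≤
        K.toSubfield.toSubring.comap (φ.comp ι) := by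
      rw [Subring.closure_le]
      intro z hz
      exact IntermediateField.subset_adjoin ℚ sφ ⟨ι z, hz, rfl⟩
    rw [hgen] at this
    exact fun z => this (Subring.mem_top z)
  let θ0 : Subring.closure s →+* K := (φ.comp ι).codRestrict K.toSubfield.toSubring hθ0
  have hθ1 : ∀ z : Subring.closure s, θ0 z ∈ Subring.closure s' := by
    have : Subring.closure ((Subtype.val : Subring.closure s → ℂ) ⁻¹' s) ≤
        (Subring.closure s').comap θ0 := by
      rw [Subring.closure_le]
      intro z hz
      exact Subring.subset_closure (show θ0 z ∈ s' from ⟨ι z, hz, rfl⟩)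
    rw [hgen] at this
    exact fun z => this (Subring.mem_top z)
  let θ : Subring.closure s →+* Subring.closure s' := θ0.codRestrict _ hθ1
  have hInt : ∀ (z : V) (w : K), φ z = w → IsIntegral (Subring.closure s) (z:ℂ) →
      IsIntegral (Subring.closure s') w := by
    rintro z w hzw ⟨p, hp, hpx⟩
    refine ⟨p.map θ, hp.map θ, Subtype.ext ?_⟩
    have e0 : eval₂ ι z p = 0 := by
      refine Subtype.ext ?_
      have := Polynomial.hom_eval₂ p ι V.subtype z
      exact this.trans hpx
    have e1 := Polynomial.hom_eval₂ p ι φ z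
    rw [e0, map_zero] at e1
    rw [eval₂_map]
    have e2 := Polynomial.hom_eval₂ p ((algebraMap (Subring.closure s') K).comp θ) (algebraMap K κ) w
    refine Eq.trans e2 ?_
    have e3 : (algebraMap K κ) w = φ z := hzw.symm
    rw [e3]
    exact e1.symm
  refine ⟨V, hcl, h1, K.toSubfield, fun z hz => hθ0 ⟨z, hz⟩, ?_⟩
  refine ((fg_unit_finite K s' hs').image (Subtype.val : K → κ)).subset ?_
  rintro w ⟨hwK, u, hu, hu0, hu1, i1, i2, i3, i4⟩
  have m2 := mem_valuationSubring_of_integral V _ hcl i2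
  have m4 := mem_valuationSubring_of_integral V _ hcl i4
  have p2 : φ u * φ ⟨_, m2⟩ = 1 := by
    rw [← map_mul, show u * ⟨_, m2⟩ = (1 : V) from Subtype.ext (mul_inv_cancel₀ hu0), map_one]
  have p4 : φ (1 - u) * φ ⟨_, m4⟩ = 1 := by
    rw [← map_mul, show (1 - u) * ⟨_, m4⟩ = (1 : V) from Subtype.ext (mul_inv_cancel₀ hu1), map_one]
  have hu' : φ u = w := hu
  have hw0 : w ≠ 0 := by
    rintro rfl; rw [hu', zero_mul] at p2; exact zero_ne_one p2
  have hw1 : 1 - w ≠ 0 := by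
    intro h; rw [map_sub, map_one, hu', h, zero_mul] at p4; exact zero_ne_one p4
  refine ⟨⟨w, hwK⟩, ⟨?_, ?_, hInt u _ hu' i1, hInt ⟨_, m2⟩ _ ?_ i2, hInt (1 - u) _ ?_ i3,
    hInt ⟨_, m4⟩ _ ?_ i4⟩, rfl⟩
  · intro h; exact hw0 (congrArg Subtype.val h)
  · intro h; exact hw1 (congrArg Subtype.val h)
  · rw [eq_comm]
    refine inv_eq_of_mul_eq_one_right ?_
    show w * _ = 1
    rw [← hu']; exact p2
  · rw [map_sub, map_one, hu']; rfl
  · rw [eq_comm]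
    refine inv_eq_of_mul_eq_one_right ?_
    show (1 - w) * _ = 1
    rw [← hu', ← map_one φ, ← map_sub, map_one]; exact p4

end part4


section part5

/-- `r` is defined at `l` with value `c` -/
def EV (l : ℂ) (r : RatFunc ℂ) (c : ℂ) : Prop :=
  ∃ n d : ℂ[X], d.eval l ≠ 0 ∧ r * algebraMap ℂ[X] (RatFunc ℂ) d = algebraMap ℂ[X] (RatFunc ℂ) n ∧
    c * d.eval l = n.eval l

lemma ratfunc_map_ne {d : ℂ[X]} (h : d ≠ 0) : algebraMap ℂ[X] (RatFunc ℂ) d ≠ 0 :=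
  RatFunc.algebraMap_ne_zero h

lemma ne_zero_of_eval_ne {d : ℂ[X]} {l : ℂ} (h : d.eval l ≠ 0) : d ≠ 0 := by
  rintro rfl; simp at h

lemma EV.add {l : ℂ} {r r' : RatFunc ℂ} {c c' : ℂ} (h : EV l r c) (h' : EV l r' c') :
    EV l (r + r') (c + c') := by
  obtain ⟨n, d, h1, h2, h3⟩ := h
  obtain ⟨n', d', h1', h2', h3'⟩ := h'
  refine ⟨n * d' + n' * d, d * d', ?_, ?_, ?_⟩
  · rw [eval_mul]; exact mul_ne_zero h1 h1'
  · simp only [map_mul, map_add, ← h2, ← h2']; ring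
  · simp only [eval_mul, eval_add, ← h3, ← h3']; ring

lemma EV.mul {l : ℂ} {r r' : RatFunc ℂ} {c c' : ℂ} (h : EV l r c) (h' : EV l r' c') :
    EV l (r * r') (c * c') := by
  obtain ⟨n, d, h1, h2, h3⟩ := h
  obtain ⟨n', d', h1', h2', h3'⟩ := h'
  refine ⟨n * n', d * d', ?_, ?_, ?_⟩
  · rw [eval_mul]; exact mul_ne_zero h1 h1'
  · simp only [map_mul, ← h2, ← h2']; ring
  · simp only [eval_mul, ← h3, ← h3']; ring

lemma EV.inv {l : ℂ} {r : RatFunc ℂ} {c : ℂ} (h : EV l r c) (hc : c ≠ 0) : EV l r⁻¹ c⁻¹ := by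
  obtain ⟨n, d, h1, h2, h3⟩ := h
  have hn : n.eval l ≠ 0 := by rw [← h3]; exact mul_ne_zero hc h1
  have hr : r ≠ 0 := by
    rintro rfl
    rw [zero_mul] at h2
    exact ratfunc_map_ne (ne_zero_of_eval_ne hn) h2.symm
  refine ⟨d, n, hn, ?_, ?_⟩
  · rw [← h2]; field_simp
  · rw [← h3]; field_simp

lemma EV.alg (l : ℂ) (p : ℂ[X]) : EV l (algebraMap ℂ[X] (RatFunc ℂ) p) (p.eval l) :=
  ⟨p, 1, by simp, by simp, by simp⟩

lemma EV.const (l c : ℂ) : EV l (algebraMap ℂ (RatFunc ℂ) c) c := by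
  have := EV.alg l (C c)
  rw [eval_C] at this
  rwa [IsScalarTower.algebraMap_apply ℂ ℂ[X] (RatFunc ℂ)]

lemma EV.unique {l : ℂ} {r : RatFunc ℂ} {c c' : ℂ} (h : EV l r c) (h' : EV l r c') : c = c' := by
  obtain ⟨n, d, h1, h2, h3⟩ := h
  obtain ⟨n', d', h1', h2', h3'⟩ := h'
  have h4 : algebraMap ℂ[X] (RatFunc ℂ) (n * d') = algebraMap ℂ[X] (RatFunc ℂ) (n' * d) := by
    rw [map_mul, map_mul, ← h2, ← h2']; ring
  have h5 := congrArg (eval l) (RatFunc.algebraMap_injective ℂ h4)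
  rw [eval_mul, eval_mul, ← h3, ← h3'] at h5
  have h6 : (c - c') * (d.eval l * d'.eval l) = 0 := by linear_combination h5
  rcases mul_eq_zero.1 h6 with h | h
  · exact sub_eq_zero.1 h
  · exact absurd h (mul_ne_zero h1 h1')

lemma EV.exists_finite (r : RatFunc ℂ) : {l : ℂ | ¬ ∃ c, EV l r c}.Finite := by
  refine (r.denom.rootSet_finite ℂ).subset ?_
  intro l hl
  rw [mem_rootSet]
  refine ⟨r.denom_ne_zero, ?_⟩
  by_contra hc
  rw [coe_aeval_eq_eval] at hc
  refine hl ⟨r.num.eval l / r.denom.eval l, r.num, r.denom, hc, ?_, ?_⟩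
  · nth_rewrite 1 [← RatFunc.num_div_denom r]
    exact div_mul_cancel₀ _ (ratfunc_map_ne r.denom_ne_zero)
  · field_simp

lemma EV.of_eval {r : RatFunc ℂ} {l : ℂ} (h : r.denom.eval l ≠ 0) :
    EV l r (r.eval (RingHom.id ℂ) l) := by
  refine ⟨r.num, r.denom, h, ?_, ?_⟩
  · nth_rewrite 1 [← RatFunc.num_div_denom r]
    exact div_mul_cancel₀ _ (ratfunc_map_ne r.denom_ne_zero)
  · rw [RatFunc.eval, eval₂_id, eval₂_id]
    field_simp

lemma EV.fiber_finite {r : RatFunc ℂ} {c : ℂ} (h : r ≠ algebraMap ℂ (RatFunc ℂ) c) :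
    {l : ℂ | EV l r c}.Finite := by
  set n := r.num - C c * r.denom with hn
  have h0 : r * algebraMap ℂ[X] (RatFunc ℂ) r.denom = algebraMap ℂ[X] (RatFunc ℂ) r.num := by
    nth_rewrite 1 [← RatFunc.num_div_denom r]
    exact div_mul_cancel₀ _ (ratfunc_map_ne r.denom_ne_zero)
  have hn0 : n ≠ 0 := by
    intro h1
    have h2 := congrArg (algebraMap ℂ[X] (RatFunc ℂ)) h1
    rw [hn, map_sub, map_mul, ← h0, map_zero, ← sub_mul] at h2
    rcases mul_eq_zero.1 h2 with h3 | h3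
    · apply h
      rw [IsScalarTower.algebraMap_apply ℂ ℂ[X] (RatFunc ℂ)]
      exact sub_eq_zero.1 h3
    · exact ratfunc_map_ne r.denom_ne_zero h3
  refine (n.rootSet_finite ℂ).subset ?_
  intro l hl
  rw [mem_rootSet, coe_aeval_eq_eval]
  refine ⟨hn0, ?_⟩
  have h1 := EV.mul hl (EV.alg l r.denom)
  rw [h0] at h1
  have h2 := h1.unique (EV.alg l r.num)
  rw [hn, eval_sub, eval_mul, eval_C, h2, sub_self]

/-- the graph of evaluation -/
def evGraph (l : ℂ) : Subalgebra ℂ (RatFunc ℂ × ℂ) where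
  carrier := {x | EV l x.1 x.2}
  mul_mem' := fun h h' => EV.mul h h'
  add_mem' := fun h h' => EV.add h h'
  algebraMap_mem' := fun c => EV.const l c

lemma EV.aeval {l : ℂ} {r : RatFunc ℂ} {c : ℂ} (h : EV l r c) (p : ℂ[X]) :
    EV l (Polynomial.aeval r p) (p.eval c) := by
  have h1 : Polynomial.aeval ((r, c) : RatFunc ℂ × ℂ) p ∈ evGraph l :=
    Algebra.adjoin_le (Set.singleton_subset_iff.2 (show (r, c) ∈ evGraph l from h))
      (aeval_mem_adjoin_singleton ℂ _)
  have h2 : EV l (AlgHom.fst ℂ (RatFunc ℂ) ℂ (Polynomial.aeval ((r, c) : RatFunc ℂ × ℂ) p))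
    (AlgHom.snd ℂ (RatFunc ℂ) ℂ (Polynomial.aeval ((r, c) : RatFunc ℂ × ℂ) p)) := h1
  rw [← Polynomial.aeval_algHom_apply, ← Polynomial.aeval_algHom_apply] at h2
  simpa using h2

lemma EV.mvaeval {l : ℂ} {r r' : RatFunc ℂ} {c c' : ℂ} (h : EV l r c) (h' : EV l r' c')
    (p : MvPolynomial (Fin 2) ℂ) :
    EV l (MvPolynomial.aeval ![r, r'] p) (MvPolynomial.aeval ![c, c'] p) := by
  induction p using MvPolynomial.induction_on with
  | C a => simpa using EV.const l a
  | add p q hp hq => simpa using EV.add hp hq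
  | mul_X p i hp =>
    rw [map_mul, map_mul, MvPolynomial.aeval_X, MvPolynomial.aeval_X]
    refine EV.mul hp ?_
    fin_cases i
    · exact h
    · exact h'

lemma homogenize (N1 M1 N2 M2 : ℂ[X]) (b : MvPolynomial (Fin 2) ℂ) :
    ∃ (G : ℂ[X]) (r t : ℕ), ∀ (A : Type) [CommRing A] [Algebra ℂ A] (x y w : A),
      x * aeval w M1 = aeval w N1 → y * aeval w M2 = aeval w N2 →
      aeval w G = MvPolynomial.aeval ![x, y] b * (aeval w M1)^r * (aeval w M2)^t := by
  induction b using MvPolynomial.induction_on with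
  | C a => exact ⟨C a, 0, 0, fun A _ _ x y w _ _ => by simp⟩
  | add p q hp hq =>
    obtain ⟨G, r, t, h⟩ := hp
    obtain ⟨G', r', t', h'⟩ := hq
    refine ⟨G * M1^r' * M2^t' + G' * M1^r * M2^t, r + r', t + t', fun A _ _ x y w h1 h2 => ?_⟩
    simp only [map_add, map_mul, map_pow, h A x y w h1 h2, h' A x y w h1 h2]
    ring
  | mul_X p i hp =>
    obtain ⟨G, r, t, h⟩ := hp
    fin_cases i
    · refine ⟨G * N1, r+1, t, fun A _ _ x y w h1 h2 => ?_⟩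
      simp only [map_mul, h A x y w h1 h2, ← h1, MvPolynomial.aeval_X]
      simp
      ring
    · refine ⟨G * N2, r, t+1, fun A _ _ x y w h1 h2 => ?_⟩
      simp only [map_mul, h A x y w h1 h2, ← h2, MvPolynomial.aeval_X]
      simp
      ring


theorem no_unit_param (C1 C2 u : RatFunc ℂ) (N1 M1 N2 M2 P Q : ℂ[X])
    (h1 : C1 * aeval u M1 = aeval u N1) (h2 : C2 * aeval u M2 = aeval u N2)
    (hM1 : aeval u M1 ≠ 0) (hM2 : aeval u M2 ≠ 0) (bez : P * N1 + Q * M1 = 1)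
    (a b : MvPolynomial (Fin 2) ℂ) (hb : MvPolynomial.aeval ![C1, C2] b ≠ 0)
    (hab : u * MvPolynomial.aeval ![C1, C2] b = MvPolynomial.aeval ![C1, C2] a)
    (α δ : ℂ) (hα : ∀ n : ℕ, 1 ≤ n → α ^ n ≠ 1) (hα0 : α ≠ 0) (s : Set ℂ) (hs : s.Finite)
    (Λ : Set ℂ) (hΛ : Λ.Infinite) (hC1 : ∀ k, C1 ≠ algebraMap ℂ (RatFunc ℂ) k)
    (hpt : ∀ l ∈ Λ, ∃ (m n : ℕ) (w : ℂ), EV l C1 (α^m) ∧ EV l C2 (δ^n) ∧ EV l u w ∧ w ≠ 0 ∧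
      1 - w ≠ 0 ∧ IsIntegral (Subring.closure s) w ∧ IsIntegral (Subring.closure s) w⁻¹ ∧
      IsIntegral (Subring.closure s) (1 - w) ∧ IsIntegral (Subring.closure s) (1 - w)⁻¹) :
    False := by
  classical
  obtain ⟨G, r, t, hG⟩ := homogenize N1 M1 N2 M2 b
  have hG0 : G ≠ 0 := by
    rintro rfl
    have := hG (RatFunc ℂ) C1 C2 u h1 h2
    rw [map_zero] at this
    exact (mul_ne_zero (mul_ne_zero hb (pow_ne_zero _ hM1)) (pow_ne_zero _ hM2)) this.symm
  set S : Set ℂ := s ∪ ({α, δ, α⁻¹, G.leadingCoeff⁻¹} ∪ (N1.coeffs ∪ M1.coeffs ∪ P.coeffs ∪ Q.coeffs ∪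
    M2.coeffs ∪ G.coeffs ∪ a.support.image a.coeff ∪ b.support.image b.coeff : Finset ℂ)) with hS
  have hSf : S.Finite := hs.union ((by simp : ({α, δ, α⁻¹, G.leadingCoeff⁻¹} : Set ℂ).Finite).union
    (Finset.finite_toSet _))
  obtain ⟨V, hcl, hroot, K0, hK0, hfin⟩ := specialization S hSf α hα
  have hSc : S ⊆ (Subring.closure S : Set ℂ) := Subring.subset_closure
  have mα : α ∈ Subring.closure S := hSc (by simp [hS])
  have mα' : α⁻¹ ∈ Subring.closure S := hSc (by simp [hS])
  have mδ : δ ∈ Subring.closure S := hSc (by simp [hS])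
  have mG : G.leadingCoeff⁻¹ ∈ Subring.closure S := hSc (by simp [hS])
  have hSV : S ⊆ (V.toSubring : Set ℂ) := hSc.trans hcl
  have hcoef : ∀ p : ℂ[X], (p.coeffs : Set ℂ) ⊆ S → ∃ pV : V[X], pV.map V.subtype = p := by
    intro p hp
    exact ⟨p.toSubring V.toSubring (hp.trans hSV), p.map_toSubring V.toSubring (hp.trans hSV)⟩
  obtain ⟨N1V, hN1V⟩ := hcoef N1 (by intro x hx; simp only [Finset.mem_coe] at hx; simp [hS, hx])
  obtain ⟨M1V, hM1V⟩ := hcoef M1 (by intro x hx; simp only [Finset.mem_coe] at hx; simp [hS, hx])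
  obtain ⟨PV, hPV⟩ := hcoef P (by intro x hx; simp only [Finset.mem_coe] at hx; simp [hS, hx])
  obtain ⟨QV, hQV⟩ := hcoef Q (by intro x hx; simp only [Finset.mem_coe] at hx; simp [hS, hx])
  obtain ⟨M2V, hM2V⟩ := hcoef M2 (by intro x hx; simp only [Finset.mem_coe] at hx; simp [hS, hx])
  obtain ⟨GV, hGV⟩ := hcoef G (by intro x hx; simp only [Finset.mem_coe] at hx; simp [hS, hx])
  have hmv : ∀ (p : MvPolynomial (Fin 2) ℂ), (∀ i ∈ p.support, p.coeff i ∈ Subring.closure S) →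
      ∀ m n : ℕ, MvPolynomial.aeval ![α^m, δ^n] p ∈ Subring.closure S := by
    intro p hp m n
    rw [MvPolynomial.aeval_eq_eval]
    show MvPolynomial.eval ![α^m, δ^n] p ∈ _
    rw [MvPolynomial.eval_eq]
    refine Subring.sum_mem _ (fun i hi => Subring.mul_mem _ (hp i hi) (Subring.prod_mem _ ?_))
    intro j _
    refine Subring.pow_mem _ ?_ _
    fin_cases j
    · exact Subring.pow_mem _ mα _
    · exact Subring.pow_mem _ mδ _
  have hma := hmv a (fun i hi => hSc (by
    rw [hS]; right; right
    simp only [Finset.coe_union, Finset.coe_image]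
    left; right
    exact ⟨i, hi, rfl⟩))
  have hmb := hmv b (fun i hi => hSc (by
    rw [hS]; right; right
    simp only [Finset.coe_union, Finset.coe_image]
    right
    exact ⟨i, hi, rfl⟩))
  let κ := IsLocalRing.ResidueField V
  let φ : V →+* κ := IsLocalRing.residue V
  have hev : ∀ (pV : V[X]) (w : V), ((pV.eval w : V) : ℂ) = (pV.map V.subtype).eval (w : ℂ) := by
    intro pV w
    rw [eval_map]
    exact Polynomial.hom_eval₂ pV (RingHom.id V) V.subtype w
  have hevφ : ∀ (pV : V[X]) (w : V), φ (pV.eval w) = (pV.map φ).eval (φ w) := by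
    intro pV w
    rw [eval_map]
    exact Polynomial.hom_eval₂ pV (RingHom.id V) φ w
  have hGφ : GV.map φ ≠ 0 := by
    intro h0
    have h3 : φ (GV.coeff G.natDegree) = 0 := by
      rw [← coeff_map, h0, coeff_zero]
    have h4 : ((GV.coeff G.natDegree : V) : ℂ) = G.leadingCoeff := by
      conv_rhs => rw [leadingCoeff, ← hGV]
      rw [coeff_map, hGV]; rfl
    have h5 : GV.coeff G.natDegree * ⟨_, hcl mG⟩ = (1 : V) := by
      refine Subtype.ext ?_
      show ((GV.coeff G.natDegree : V) : ℂ) * G.leadingCoeff⁻¹ = 1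
      rw [h4]
      exact mul_inv_cancel₀ (leadingCoeff_ne_zero.2 hG0)
    have h6 := congrArg φ h5
    rw [map_mul, h3, zero_mul, map_one] at h6
    exact zero_ne_one h6
  have hbezV : PV * N1V + QV * M1V = 1 := by
    apply Polynomial.map_injective V.subtype Subtype.val_injective
    rw [Polynomial.map_add, Polynomial.map_mul, Polynomial.map_mul, hPV, hN1V, hQV, hM1V, bez,
      Polynomial.map_one]
  have mono : Subring.closure s ≤ Subring.closure S := Subring.closure_mono Set.subset_union_left
  have hInt : ∀ z : ℂ, IsIntegral (Subring.closure s) z → IsIntegral (Subring.closure S) z := by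
    intro z hz
    exact IsIntegral.map_of_comp_eq (R := Subring.closure s) (T := Subring.closure S) (S := ℂ) (U := ℂ)
      (Subring.inclusion mono) (RingHom.id ℂ) rfl hz
  have hpt2 : ∀ l : Λ, ∃ (m n : ℕ) (w : V), EV l C1 (α^m) ∧ EV l C2 (δ^n) ∧ EV l u w ∧ (w:ℂ) ≠ 0 ∧
      1 - (w:ℂ) ≠ 0 ∧ IsIntegral (Subring.closure S) (w:ℂ) ∧ IsIntegral (Subring.closure S) (w:ℂ)⁻¹ ∧
      IsIntegral (Subring.closure S) (1 - (w:ℂ)) ∧ IsIntegral (Subring.closure S) (1 - (w:ℂ))⁻¹ := by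
    rintro ⟨l, hl⟩
    obtain ⟨m, n, w, e1, e2, e3, e4, e5, e6, e7, e8, e9⟩ := hpt l hl
    exact ⟨m, n, ⟨w, mem_valuationSubring_of_integral V _ hcl (hInt _ e6)⟩, e1, e2, e3, e4, e5,
      hInt _ e6, hInt _ e7, hInt _ e8, hInt _ e9⟩
  choose m n w e1 e2 e3 e4 e5 e6 e7 e8 e9 using hpt2
  -- identities at the points
  have i1 : ∀ l : Λ, α^(m l) * M1.eval (w l : ℂ) = N1.eval (w l : ℂ) := fun l => by
    have := (e1 l).mul ((e3 l).aeval M1)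
    rw [h1] at this
    exact this.unique ((e3 l).aeval N1)
  have i2 : ∀ l : Λ, δ^(n l) * M2.eval (w l : ℂ) = N2.eval (w l : ℂ) := fun l => by
    have := (e2 l).mul ((e3 l).aeval M2)
    rw [h2] at this
    exact this.unique ((e3 l).aeval N2)
  have i3 : ∀ l : Λ, (w l : ℂ) * MvPolynomial.aeval ![α^(m l), δ^(n l)] b =
      MvPolynomial.aeval ![α^(m l), δ^(n l)] a := fun l => by
    have := (e3 l).mul ((e1 l).mvaeval (e2 l) b)
    rw [hab] at this
    exact this.unique ((e1 l).mvaeval (e2 l) a)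
  set αV : V := ⟨α, hcl mα⟩ with hαV
  have hφα : φ αV ≠ 0 := by
    intro h0
    have h5 : αV * ⟨_, hcl mα'⟩ = (1 : V) := Subtype.ext (mul_inv_cancel₀ hα0)
    have h6 := congrArg φ h5
    rw [map_mul, h0, zero_mul, map_one] at h6
    exact zero_ne_one h6
  have i1φ : ∀ l : Λ, φ αV ^ (m l) * (M1V.map φ).eval (φ (w l)) = (N1V.map φ).eval (φ (w l)) := by
    intro l
    have : αV ^ (m l) * M1V.eval (w l) = N1V.eval (w l) := by
      refine Subtype.ext ?_
      have := i1 l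
      rw [← hM1V, ← hN1V, ← hev, ← hev] at this
      exact this
    rw [← hevφ, ← hevφ, ← map_pow, ← map_mul, this]
  -- finite range
  have hrange : ∀ l : Λ, φ (w l) ∈ ((GV.map φ).roots.toFinset : Set κ) ∪ {w | w ∈ K0 ∧ ∃ u : V, IsLocalRing.residue V u = w ∧ (u : ℂ) ≠ 0 ∧ 1 - (u : ℂ) ≠ 0 ∧
          IsIntegral (Subring.closure S) (u : ℂ) ∧ IsIntegral (Subring.closure S) (u : ℂ)⁻¹ ∧
          IsIntegral (Subring.closure S) (1 - (u : ℂ)) ∧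
          IsIntegral (Subring.closure S) (1 - (u : ℂ))⁻¹} := by
    intro l
    by_cases hr : (GV.map φ).eval (φ (w l)) = 0
    · left
      simp only [Finset.mem_coe, Multiset.mem_toFinset]
      exact (mem_roots hGφ).2 hr
    · right
      refine ⟨?_, w l, rfl, e4 l, e5 l, e6 l, e7 l, e8 l, e9 l⟩
      have hGl := hG ℂ (α^(m l)) (δ^(n l)) (w l) (by simpa using i1 l) (by simpa using i2 l)
      set bV : V := ⟨_, hcl (hmb (m l) (n l))⟩ with hbV
      set aV : V := ⟨_, hcl (hma (m l) (n l))⟩ with haV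
      have j1 : GV.eval (w l) = bV * (M1V.eval (w l))^r * (M2V.eval (w l))^t := by
        refine Subtype.ext ?_
        rw [hev, hGV]
        simp only [coe_aeval_eq_eval] at hGl
        rw [hGl, ← hM1V, ← hM2V, ← hev, ← hev]
        rfl
      have j2 : φ bV ≠ 0 := by
        intro h0
        apply hr
        rw [← hevφ, j1, map_mul, map_mul, h0, zero_mul, zero_mul]
      have j3 : w l * bV = aV := Subtype.ext (i3 l)
      have j4 : φ (w l) = φ aV / φ bV := by
        rw [eq_div_iff j2, ← map_mul, j3]
      show φ (w l) ∈ K0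
      rw [j4]
      exact K0.div_mem (hK0 aV (hma _ _)) (hK0 bV (hmb _ _))
  have hF := ((GV.map φ).roots.toFinset.finite_toSet).union hfin
  have : Infinite Λ := hΛ.to_subtype
  have hfib : ∃ ω : κ, {l : Λ | φ (w l) = ω}.Infinite := by
    by_contra hc
    push Not at hc
    have : (Set.univ : Set Λ).Finite := by
      refine (hF.biUnion (t := fun ω => {l : Λ | φ (w l) = ω}) (fun ω _ => hc ω)).subset ?_
      intro l _
      exact Set.mem_biUnion (hrange l) rfl
    exact Set.infinite_univ this
  obtain ⟨ω, hω⟩ := hfib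
  obtain ⟨l1, hl1⟩ := hω.nonempty
  have hfin2 : {l : Λ | EV l C1 (α^(m l1))}.Finite :=
    Set.Finite.preimage (f := (Subtype.val : Λ → ℂ)) (s := {l | EV l C1 (α^(m l1))})
      Subtype.val_injective.injOn (EV.fiber_finite (hC1 (α^(m l1))))
  obtain ⟨l2, hl2, hl2'⟩ := (hω.sdiff hfin2).nonempty
  have hne : m l1 ≠ m l2 := by
    intro h
    apply hl2'
    show EV l2 C1 (α^(m l1))
    rw [h]; exact e1 l2
  have k1 := i1φ l1
  have k2 := i1φ l2
  rw [show φ (w l1) = ω from hl1] at k1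
  rw [show φ (w l2) = ω from hl2] at k2
  have hpow : φ αV ^ (m l1) ≠ φ αV ^ (m l2) := by
    have key : ∀ i j : ℕ, i < j → φ αV ^ i ≠ φ αV ^ j := by
      intro i j hij h
      obtain ⟨k, rfl⟩ := Nat.exists_eq_add_of_lt hij
      refine hroot (hcl mα) (k+1) (by omega) ?_
      have : φ αV ^ i * (φ αV ^ (k+1)) = φ αV ^ i * 1 := by
        rw [mul_one]; nth_rewrite 2 [h]; rw [← pow_add]; rfl
      exact mul_left_cancel₀ (pow_ne_zero _ hφα) this
    rcases lt_or_gt_of_ne hne with h | h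
    · exact key _ _ h
    · exact (key _ _ h).symm
  have k3 : (M1V.map φ).eval ω = 0 := by
    have : (φ αV ^ (m l1) - φ αV ^ (m l2)) * (M1V.map φ).eval ω = 0 := by
      rw [sub_mul, k1, k2, sub_self]
    rcases mul_eq_zero.1 this with h | h
    · exact absurd (sub_eq_zero.1 h) hpow
    · exact h
  have k4 : (N1V.map φ).eval ω = 0 := by rw [← k1, k3, mul_zero]
  have k5 := congrArg (fun p : V[X] => (p.map φ).eval ω) hbezV
  simp only [Polynomial.map_add, Polynomial.map_mul, eval_add, eval_mul, k3, k4, mul_zero, add_zero,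
    Polynomial.map_one, eval_one] at k5
  exact zero_ne_one k5

end part5


section part6

lemma EV.one (l : ℂ) : EV l 1 1 := by
  have := EV.const l 1
  rwa [map_one] at this

lemma EV.pow {l : ℂ} {r : RatFunc ℂ} {c : ℂ} (h : EV l r c) (k : ℕ) : EV l (r^k) (c^k) := by
  induction k with
  | zero => rw [pow_zero, pow_zero]; exact EV.one l
  | succ k ih => rw [pow_succ, pow_succ]; exact ih.mul h

lemma EV.zpow {l : ℂ} {r : RatFunc ℂ} {c : ℂ} (h : EV l r c) (hc : c ≠ 0) (k : ℤ) :
    EV l (r^k) (c^k) := by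
  cases k with
  | ofNat k => simpa using h.pow k
  | negSucc k =>
    rw [zpow_negSucc, zpow_negSucc]
    exact (h.pow _).inv (pow_ne_zero _ hc)

lemma EV.prod {l : ℂ} (Z : Finset ℂ) (r : ℂ → RatFunc ℂ) (c : ℂ → ℂ)
    (h : ∀ z ∈ Z, EV l (r z) (c z)) : EV l (∏ z ∈ Z, r z) (∏ z ∈ Z, c z) := by
  classical
  induction Z using Finset.induction_on with
  | empty => simpa using EV.one l
  | insert a s ha ih =>
    rw [Finset.prod_insert ha, Finset.prod_insert ha]
    exact (h a (Finset.mem_insert_self _ _)).mul (ih (fun z hz => h z (Finset.mem_insert_of_mem hz)))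

lemma EV.sub_const {l : ℂ} {r : RatFunc ℂ} {c : ℂ} (h : EV l r c) (z : ℂ) :
    EV l (r - algebraMap ℂ (RatFunc ℂ) z) (c - z) := by
  have := h.add (EV.const l (-z))
  rwa [map_neg, ← sub_eq_add_neg, ← sub_eq_add_neg] at this

lemma aeval_factor (T : RatFunc ℂ) (p : ℂ[X]) :
    aeval T p = algebraMap ℂ (RatFunc ℂ) p.leadingCoeff *
      ∏ z ∈ p.roots.toFinset, (T - algebraMap ℂ (RatFunc ℂ) z) ^ (p.roots.count z) := by
  classical
  conv_lhs => rw [(IsAlgClosed.splits p).eq_prod_roots]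
  rw [map_mul, aeval_C, map_multiset_prod, Multiset.map_map, Finset.prod_multiset_map_count]
  congr 1
  refine Finset.prod_congr rfl (fun z _ => ?_)
  simp

lemma factor_exists (T C : RatFunc ℂ) (hC : C ≠ 0) (hT : ∀ k, T ≠ algebraMap ℂ (RatFunc ℂ) k)
    (h : C ∈ IntermediateField.adjoin ℂ {T}) :
    ∃ (κ : ℂ) (Z : Finset ℂ) (e : ℂ → ℤ), κ ≠ 0 ∧ ∀ W : Finset ℂ, Z ⊆ W →
      (C = algebraMap ℂ (RatFunc ℂ) κ * ∏ z ∈ W, (T - algebraMap ℂ (RatFunc ℂ) z) ^ (e z)) := by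
  classical
  obtain ⟨r, s, hrs⟩ := (IntermediateField.mem_adjoin_simple_iff ℂ C).1 h
  have hr : r ≠ 0 := by rintro rfl; simp at hrs; exact hC hrs
  have hs : s ≠ 0 := by rintro rfl; simp at hrs; exact hC hrs
  refine ⟨r.leadingCoeff / s.leadingCoeff, r.roots.toFinset ∪ s.roots.toFinset,
    fun z => (r.roots.count z : ℤ) - s.roots.count z,
    div_ne_zero (leadingCoeff_ne_zero.2 hr) (leadingCoeff_ne_zero.2 hs), fun W hW => ?_⟩
  have key : ∀ p : ℂ[X], p.roots.toFinset ⊆ W → aeval T p = algebraMap ℂ (RatFunc ℂ) p.leadingCoeff *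
      ∏ z ∈ W, (T - algebraMap ℂ (RatFunc ℂ) z) ^ (p.roots.count z) := by
    intro p hp
    rw [aeval_factor]
    congr 1
    refine Finset.prod_subset hp (fun z _ hz => ?_)
    rw [Multiset.mem_toFinset] at hz
    rw [Multiset.count_eq_zero_of_notMem hz, pow_zero]
  rw [hrs, key r (Finset.union_subset_left hW), key s (Finset.union_subset_right hW), map_div₀,
    mul_div_mul_comm, ← Finset.prod_div_distrib]
  congr 1
  refine Finset.prod_congr rfl (fun z _ => ?_)
  rw [zpow_sub₀ (sub_ne_zero.2 (hT z)), zpow_natCast, zpow_natCast]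

/-- product formula in a valuation -/
lemma val_pf {Γ : Type*} [LinearOrderedCommGroupWithZero Γ] (v : Valuation ℂ Γ) (Z : Finset ℂ)
    (e : ℂ → ℤ) (τ κ x : ℂ) (hκ : v κ = 1) (hx : v x = 1)
    (hxe : x = κ * ∏ z ∈ Z, (τ - z) ^ (e z)) : ∏ z ∈ Z, v (τ - z) ^ (e z) = 1 := by
  have := congrArg v hxe
  rw [map_mul, hκ, hx, one_mul, map_prod] at this
  simp only [map_zpow₀] at this
  exact this.symm

lemma val_big {Γ : Type*} [LinearOrderedCommGroupWithZero Γ] (v : Valuation ℂ Γ) (z τ : ℂ)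
    (hz : v z ≤ 1) (hτ : 1 < v τ) : v (τ - z) = v τ :=
  v.map_sub_eq_of_lt_left (lt_of_le_of_lt hz hτ)

lemma val_big_sum {Γ : Type*} [LinearOrderedCommGroupWithZero Γ] (v : Valuation ℂ Γ) (Z : Finset ℂ)
    (e : ℂ → ℤ) (τ : ℂ) (hz : ∀ z ∈ Z, v z ≤ 1) (hpf : ∏ z ∈ Z, v (τ - z) ^ (e z) = 1)
    (hτ : 1 < v τ) : ∑ z ∈ Z, e z = 0 := by
  have h1 : ∏ z ∈ Z, v (τ - z) ^ (e z) = v τ ^ (∑ z ∈ Z, e z) := by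
    have h0 : v τ ≠ 0 := (lt_trans zero_lt_one hτ).ne'
    rw [← Finset.prod_congr rfl (fun z hzz => by rw [val_big v z τ (hz z hzz) hτ])]
    clear hpf hz
    induction Z using Finset.induction_on with
    | empty => simp
    | insert a s ha ih => rw [Finset.prod_insert ha, Finset.sum_insert ha, zpow_add₀ h0, ih]
  rw [h1] at hpf
  exact (zpow_eq_one_iff_right₀ zero_le' hτ.ne').1 hpf

lemma val_small {Γ : Type*} [LinearOrderedCommGroupWithZero Γ] (v : Valuation ℂ Γ) (Z : Finset ℂ)
    (e1 e2 : ℂ → ℤ) (τ : ℂ) (hz : ∀ z ∈ Z, v z ≤ 1)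
    (hzz : ∀ z ∈ Z, ∀ y ∈ Z, z ≠ y → v (z - y) = 1)
    (he : ∀ z ∈ Z, e1 z ≠ 0 ∨ e2 z ≠ 0)
    (hpf1 : ∏ z ∈ Z, v (τ - z) ^ (e1 z) = 1) (hpf2 : ∏ z ∈ Z, v (τ - z) ^ (e2 z) = 1)
    (hτ : v τ ≤ 1) : ∀ z ∈ Z, v (τ - z) = 1 := by
  intro z0 hz0
  have hle : v (τ - z0) ≤ 1 := (v.map_sub _ _).trans (max_le hτ (hz z0 hz0))
  by_contra hne
  have hlt : v (τ - z0) < 1 := lt_of_le_of_ne hle hne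
  have hoth : ∀ y ∈ Z, y ≠ z0 → v (τ - y) = 1 := by
    intro y hy hyz
    have h1 := hzz z0 hz0 y hy hyz.symm
    have : v ((τ - z0) + (z0 - y)) = v (z0 - y) := v.map_add_eq_of_lt_right (by rw [h1]; exact hlt)
    rwa [sub_add_sub_cancel, h1] at this
  have key : ∀ e : ℂ → ℤ, ∏ z ∈ Z, v (τ - z) ^ (e z) = 1 → e z0 = 0 := by
    intro e h
    rw [Finset.prod_eq_single z0 (fun b hb hbz => by rw [hoth b hb hbz, one_zpow])
      (fun h => absurd hz0 h)] at h
    exact (zpow_eq_one_iff_right₀ zero_le' hlt.ne).1 h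
  rcases he z0 hz0 with h | h
  · exact h (key e1 hpf1)
  · exact h (key e2 hpf2)

lemma isIntegral_of_val (s : Set ℂ) (w : ℂ)
    (h : ∀ V : ValuationSubring ℂ, s ⊆ V.toSubring → V.valuation w ≤ 1) :
    IsIntegral (Subring.closure s) w := by
  have h1 : w ∈ (integralClosure (Subring.closure s) ℂ).toSubring := by
    rw [← iInf_valuationSubring_superset, Subring.mem_iInf]
    rintro ⟨V, hV⟩
    exact (V.valuation_le_one_iff w).1 (h V hV)
  exact h1

lemma val_one_of_mem (V : ValuationSubring ℂ) (x : ℂ) (hx0 : x ≠ 0) (h1 : x ∈ V) (h2 : x⁻¹ ∈ V) :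
    V.valuation x = 1 := by
  refine le_antisymm ((V.valuation_le_one_iff x).2 h1) ?_
  have h := (V.valuation_le_one_iff _).2 h2
  rw [map_inv₀] at h
  have h0 : V.valuation x ≠ 0 := (Valuation.ne_zero_iff _).2 hx0
  exact (inv_le_one₀ (zero_lt_iff.2 h0)).1 h

lemma no_unit_param_field (C1 C2 u : RatFunc ℂ)
    (h1 : C1 ∈ IntermediateField.adjoin ℂ {u}) (h2 : C2 ∈ IntermediateField.adjoin ℂ {u})
    (hu : u ∈ IntermediateField.adjoin ℂ (Set.range ![C1, C2])) (hu0 : u ≠ 0)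
    (α δ : ℂ) (hα : ∀ n : ℕ, 1 ≤ n → α ^ n ≠ 1) (hα0 : α ≠ 0) (s : Set ℂ) (hs : s.Finite)
    (Λ : Set ℂ) (hΛ : Λ.Infinite) (hC1 : ∀ k, C1 ≠ algebraMap ℂ (RatFunc ℂ) k)
    (hC2 : ∀ k, C2 ≠ algebraMap ℂ (RatFunc ℂ) k)
    (hpt : ∀ l ∈ Λ, ∃ (m n : ℕ) (w : ℂ), EV l C1 (α^m) ∧ EV l C2 (δ^n) ∧ EV l u w ∧ w ≠ 0 ∧
      1 - w ≠ 0 ∧ ∀ V : ValuationSubring ℂ, s ⊆ V.toSubring →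
        V.valuation w = 1 ∧ V.valuation (1 - w) = 1) :
    False := by
  classical
  have hne : ∀ C : RatFunc ℂ, (∀ k, C ≠ algebraMap ℂ (RatFunc ℂ) k) → C ≠ 0 := fun C h h0 =>
    h 0 (by rw [h0, map_zero])
  obtain ⟨r1, s1, hr1⟩ := (IntermediateField.mem_adjoin_simple_iff ℂ C1).1 h1
  obtain ⟨r2, s2, hr2⟩ := (IntermediateField.mem_adjoin_simple_iff ℂ C2).1 h2
  obtain ⟨a, b, hab⟩ := (IntermediateField.mem_adjoin_range_iff ℂ _ u).1 hu
  have hb : MvPolynomial.aeval ![C1, C2] b ≠ 0 := by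
    intro h; rw [h, div_zero] at hab; exact hu0 hab
  have hs1 : aeval u s1 ≠ 0 := by
    intro h; rw [h, div_zero] at hr1; exact hne _ hC1 hr1
  have hs2 : aeval u s2 ≠ 0 := by
    intro h; rw [h, div_zero] at hr2; exact hne _ hC2 hr2
  have hs10 : s1 ≠ 0 := by rintro rfl; simp at hs1
  obtain ⟨P, Q, bez⟩ := isCoprime_div_gcd_div_gcd (p := r1) (q := s1) hs10
  set d := GCDMonoid.gcd r1 s1 with hd
  have e1 : d * (r1 / d) = r1 := EuclideanDomain.mul_div_cancel' (gcd_ne_zero_of_right hs10) (gcd_dvd_left _ _)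
  have e2 : d * (s1 / d) = s1 := EuclideanDomain.mul_div_cancel' (gcd_ne_zero_of_right hs10) (gcd_dvd_right _ _)
  have hmul : aeval u d * aeval u (s1 / d) = aeval u s1 := by rw [← map_mul, e2]
  have hmul1 : aeval u d * aeval u (r1 / d) = aeval u r1 := by rw [← map_mul, e1]
  have hd0 : aeval u d ≠ 0 := left_ne_zero_of_mul (by rw [hmul]; exact hs1)
  have hsd0 : aeval u (s1 / d) ≠ 0 := right_ne_zero_of_mul (by rw [hmul]; exact hs1)
  refine no_unit_param C1 C2 u (r1 / d) (s1 / d) r2 s2 P Q ?_ ?_ hsd0 hs2 bez a b hb ?_ α δ hα hα0 s hs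
    Λ hΛ hC1 ?_
  · rw [hr1, ← hmul, ← hmul1, mul_div_mul_left _ _ hd0, div_mul_cancel₀ _ hsd0]
  · rw [hr2, div_mul_cancel₀ _ hs2]
  · rw [eq_div_iff hb] at hab; exact hab
  · intro l hl
    obtain ⟨m, n, w, k1, k2, k3, k4, k5, k6⟩ := hpt l hl
    refine ⟨m, n, w, k1, k2, k3, k4, k5, isIntegral_of_val _ _ fun V hV => (k6 V hV).1.le,
      isIntegral_of_val _ _ fun V hV => ?_, isIntegral_of_val _ _ fun V hV => (k6 V hV).2.le,
      isIntegral_of_val _ _ fun V hV => ?_⟩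
    · rw [map_inv₀, (k6 V hV).1, inv_one]
    · rw [map_inv₀, (k6 V hV).2, inv_one]

end part6


section part7

theorem dependent_core (C1 C2 : RatFunc ℂ)
    (α δ : ℂ) (hα : ∀ n : ℕ, 1 ≤ n → α ^ n ≠ 1) (hα0 : α ≠ 0) (hδ0 : δ ≠ 0)
    (Λ : Set ℂ) (hΛ : Λ.Infinite) (hC1 : ∀ k, C1 ≠ algebraMap ℂ (RatFunc ℂ) k)
    (hC2 : ∀ k, C2 ≠ algebraMap ℂ (RatFunc ℂ) k)
    (hpt : ∀ l ∈ Λ, ∃ (m n : ℕ), EV l C1 (α^m) ∧ EV l C2 (δ^n)) :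
    ∃ p q : ℤ, (p ≠ 0 ∨ q ≠ 0) ∧ ∃ k, C1 ^ p * C2 ^ q = algebraMap ℂ (RatFunc ℂ) k := by
  classical
  by_contra hind
  push Not at hind
  set c := algebraMap ℂ (RatFunc ℂ) with hc
  have hcinj : Function.Injective c := (algebraMap ℂ (RatFunc ℂ)).injective
  have hne : ∀ C : RatFunc ℂ, (∀ k, C ≠ c k) → C ≠ 0 := fun C h h0 =>
    h 0 (by rw [h0, map_zero])
  set E := IntermediateField.adjoin ℂ (Set.range ![C1, C2]) with hE
  have hC1E : C1 ∈ E := IntermediateField.subset_adjoin _ _ ⟨0, rfl⟩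
  have hC2E : C2 ∈ E := IntermediateField.subset_adjoin _ _ ⟨1, rfl⟩
  have hEbot : E ≠ ⊥ := by
    intro h
    rw [h, IntermediateField.mem_bot] at hC1E
    obtain ⟨k, hk⟩ := hC1E
    exact hC1 k hk.symm
  obtain ⟨T, hT⟩ : ∃ T, T = RatFunc.Luroth.generator E := ⟨_, rfl⟩
  have hET : E = IntermediateField.adjoin ℂ {T} := by
    rw [hT]; exact RatFunc.Luroth.eq_adjoin_generator
  have hTc : ∀ k, T ≠ c k := by
    intro k hk
    exact RatFunc.Luroth.generator_ne_C hEbot ⟨k, by rw [← hT, hk]; rfl⟩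
  have hTE : T ∈ E := by rw [hET]; exact IntermediateField.mem_adjoin_simple_self ℂ T
  obtain ⟨κ1, Z1, e1, hκ1, hf1⟩ := factor_exists T C1 (hne _ hC1) hTc (hET ▸ hC1E)
  obtain ⟨κ2, Z2, e2, hκ2, hf2⟩ := factor_exists T C2 (hne _ hC2) hTc (hET ▸ hC2E)
  set Z : Finset ℂ := (Z1 ∪ Z2).filter (fun z => e1 z ≠ 0 ∨ e2 z ≠ 0) with hZ
  have he : ∀ z ∈ Z, e1 z ≠ 0 ∨ e2 z ≠ 0 := fun z hz => (Finset.mem_filter.1 hz).2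
  have hF1 : C1 = c κ1 * ∏ z ∈ Z, (T - c z) ^ (e1 z) := by
    rw [hf1 (Z1 ∪ Z2) Finset.subset_union_left]
    congr 1
    refine (Finset.prod_subset (Finset.filter_subset _ _) (fun z hz hzn => ?_)).symm
    have : e1 z = 0 := by
      by_contra h; exact hzn (Finset.mem_filter.2 ⟨hz, Or.inl h⟩)
    rw [this, zpow_zero]
  have hF2 : C2 = c κ2 * ∏ z ∈ Z, (T - c z) ^ (e2 z) := by
    rw [hf2 (Z1 ∪ Z2) Finset.subset_union_right]
    congr 1
    refine (Finset.prod_subset (Finset.filter_subset _ _) (fun z hz hzn => ?_)).symm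
    have : e2 z = 0 := by
      by_contra h; exact hzn (Finset.mem_filter.2 ⟨hz, Or.inr h⟩)
    rw [this, zpow_zero]
  clear hf1 hf2
  clear_value Z
  -- dependence when both are monomials in one function
  have hdep : ∀ (Y : RatFunc ℂ) (a1 a2 : ℤ), Y ≠ 0 → (a1 ≠ 0 ∨ a2 ≠ 0) → C1 = c κ1 * Y ^ a1 →
      C2 = c κ2 * Y ^ a2 → False := by
    intro Y a1 a2 hY ha h1 h2
    refine hind a2 (-a1) (by rcases ha with h | h <;> simp [h]) (κ1 ^ a2 * κ2 ^ (-a1)) ?_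
    rw [h1, h2, mul_zpow, mul_zpow, map_mul, map_zpow₀, map_zpow₀, ← zpow_mul, ← zpow_mul]
    have : Y ^ (a1 * a2) * Y ^ (a2 * -a1) = 1 := by
      rw [← zpow_add₀ hY, show a1 * a2 + a2 * -a1 = 0 by ring, zpow_zero]
    linear_combination (c κ1 ^ a2 * c κ2 ^ (-a1)) * this
  have hTz : ∀ z, T - c z ≠ 0 := fun z => sub_ne_zero.2 (hTc z)
  -- dichotomy
  have hdich : (∃ z1 ∈ Z, ∃ z2 ∈ Z, ∃ z3 ∈ Z, z1 ≠ z2 ∧ z1 ≠ z3 ∧ z2 ≠ z3) ∨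
      ((∃ z1 ∈ Z, ∃ z2 ∈ Z, z1 ≠ z2) ∧ ¬ (∑ z ∈ Z, e1 z = 0 ∧ ∑ z ∈ Z, e2 z = 0)) := by
    by_cases h3 : 2 < Z.card
    · left; exact Finset.two_lt_card.1 h3
    right
    have h4 : Z.card = 0 ∨ Z.card = 1 ∨ Z.card = 2 := by omega
    rcases h4 with h | h | h
    · rw [Finset.card_eq_zero] at h
      rw [h, Finset.prod_empty, mul_one] at hF1
      exact absurd hF1 (hC1 _)
    · obtain ⟨z, hz⟩ := Finset.card_eq_one.1 h
      subst hz
      rw [Finset.prod_singleton] at hF1 hF2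
      exact (hdep _ _ _ (hTz z) (he z (Finset.mem_singleton_self z)) hF1 hF2).elim
    · obtain ⟨x, y, hxy, hz⟩ := Finset.card_eq_two.1 h
      subst hz
      refine ⟨⟨x, by simp, y, by simp, hxy⟩, ?_⟩
      rintro ⟨s1, s2⟩
      rw [Finset.sum_pair hxy] at s1 s2
      rw [Finset.prod_pair hxy] at hF1 hF2
      refine hdep ((T - c x) / (T - c y)) (e1 x) (e2 x) (div_ne_zero (hTz x) (hTz y))
        (he x (by simp)) ?_ ?_
      · rw [hF1, show e1 y = - e1 x by linarith, zpow_neg, div_zpow, div_eq_mul_inv]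
      · rw [hF2, show e2 y = - e2 x by linarith, zpow_neg, div_zpow, div_eq_mul_inv]
  -- good points
  set B : Set ℂ := {l | ¬∃ t, EV l T t} ∪ ⋃ z ∈ Z, {l | EV l T z} with hB
  have hBf : B.Finite := (EV.exists_finite T).union
    (Set.Finite.biUnion Z.finite_toSet (fun z _ => EV.fiber_finite (hTc z)))
  have hΛ2 : (Λ \ B).Infinite := hΛ.sdiff hBf
  set s : Set ℂ := {α, δ, α⁻¹, δ⁻¹, κ1, κ1⁻¹, κ2, κ2⁻¹} ∪ ((Z : Set ℂ) ∪
    ((Z ×ˢ Z).image (fun p : ℂ × ℂ => (p.1 - p.2)⁻¹) : Finset ℂ)) with hs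
  have hsf : s.Finite := Set.Finite.union (by simp) ((Finset.finite_toSet _).union (Finset.finite_toSet _))
  have hzz : ∀ V : ValuationSubring ℂ, s ⊆ V.toSubring → ∀ z ∈ Z, ∀ y ∈ Z, z ≠ y →
      V.valuation (z - y) = 1 := by
    intro V hV z hz y hy hzy
    refine val_one_of_mem V _ (sub_ne_zero.2 hzy) ?_ ?_
    · exact V.toSubring.sub_mem (hV (by simp [hs, hz])) (hV (by simp [hs, hy]))
    · apply hV
      right; right
      simp only [Finset.coe_image]
      exact ⟨(z, y), by simp [hz, hy], rfl⟩
  have hpoint : ∀ l ∈ Λ \ B, ∃ (m n : ℕ) (τ : ℂ), EV l C1 (α^m) ∧ EV l C2 (δ^n) ∧ EV l T τ ∧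
      (∀ z ∈ Z, τ - z ≠ 0) ∧ ∀ V : ValuationSubring ℂ, s ⊆ V.toSubring →
        (∀ z ∈ Z, V.valuation (τ - z) = 1) ∨
        ((∑ z ∈ Z, e1 z = 0 ∧ ∑ z ∈ Z, e2 z = 0) ∧ 1 < V.valuation τ ∧
          ∀ z ∈ Z, V.valuation (τ - z) = V.valuation τ) := by
    rintro l ⟨hl, hlB⟩
    obtain ⟨m, n, hm, hn⟩ := hpt l hl
    rw [hB, Set.mem_union, not_or] at hlB
    obtain ⟨τ, hτ⟩ := not_not.1 hlB.1
    have hτZ : ∀ z ∈ Z, τ - z ≠ 0 := by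
      intro z hz h
      refine hlB.2 (Set.mem_biUnion (x := z) hz ?_)
      rw [sub_eq_zero] at h
      show EV l T z
      rw [← h]; exact hτ
    have pf : ∀ (κ : ℂ) (e : ℂ → ℤ), EV l (c κ * ∏ z ∈ Z, (T - c z) ^ (e z))
        (κ * ∏ z ∈ Z, (τ - z) ^ (e z)) := by
      intro κ e
      exact (EV.const l κ).mul (EV.prod Z _ _ (fun z hz => (hτ.sub_const z).zpow (hτZ z hz) _))
    refine ⟨m, n, τ, hm, hn, hτ, hτZ, fun V hV => ?_⟩
    have vα : V.valuation (α^m) = 1 := by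
      rw [map_pow, val_one_of_mem V α hα0 (hV (by simp [hs])) (hV (by simp [hs])), one_pow]
    have vδ : V.valuation (δ^n) = 1 := by
      rw [map_pow, val_one_of_mem V δ hδ0 (hV (by simp [hs])) (hV (by simp [hs])), one_pow]
    have v1 : V.valuation κ1 = 1 := val_one_of_mem V κ1 hκ1 (hV (by simp [hs])) (hV (by simp [hs]))
    have v2 : V.valuation κ2 = 1 := val_one_of_mem V κ2 hκ2 (hV (by simp [hs])) (hV (by simp [hs]))
    have p1 := val_pf V.valuation Z e1 τ κ1 (α^m) v1 vα ((hF1 ▸ hm).unique (pf κ1 e1))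
    have p2 := val_pf V.valuation Z e2 τ κ2 (δ^n) v2 vδ ((hF2 ▸ hn).unique (pf κ2 e2))
    have vz : ∀ z ∈ Z, V.valuation z ≤ 1 := fun z hz =>
      (V.valuation_le_one_iff z).2 (hV (by simp [hs, hz]))
    rcases le_or_gt (V.valuation τ) 1 with h | h
    · left
      exact val_small V.valuation Z e1 e2 τ vz (hzz V hV) he p1 p2 h
    · right
      exact ⟨⟨val_big_sum _ _ _ _ vz p1 h, val_big_sum _ _ _ _ vz p2 h⟩, h,
        fun z hz => val_big _ _ _ (vz z hz) h⟩
  have hcm : ∀ (K : IntermediateField ℂ (RatFunc ℂ)) (k : ℂ), c k ∈ K := fun K k => K.algebraMap_mem k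
  have hgen : ∀ u, T ∈ IntermediateField.adjoin ℂ {u} → E ≤ IntermediateField.adjoin ℂ {u} := by
    intro u hu
    rw [hET]; exact IntermediateField.adjoin_simple_le_iff.2 hu
  have hcs : ∀ x y : ℂ, x ≠ y → c x - c y ≠ 0 := fun x y hxy h =>
    hxy (hcinj (sub_eq_zero.1 h))
  rcases hdich with ⟨z1, h1, z2, h2, z3, h3, h12, h13, h23⟩ | ⟨⟨z1, h1, z2, h2, h12⟩, hsum⟩
  · set A : ℂ := (z2 - z3) / (z2 - z1) with hA
    have hA0 : A ≠ 0 := div_ne_zero (sub_ne_zero.2 h23) (sub_ne_zero.2 h12.symm)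
    have hcA0 : c A ≠ 0 := fun h => hA0 (hcinj (by rw [h, map_zero]))
    set u : RatFunc ℂ := c A * (T - c z1) * (T - c z3)⁻¹ with hu
    have hu0 : u ≠ 0 := mul_ne_zero (mul_ne_zero hcA0 (hTz _)) (inv_ne_zero (hTz _))
    have huA : u - c A ≠ 0 := by
      intro h
      have h5 : (u - c A) * (T - c z3) = c A * (c z3 - c z1) := by
        rw [hu]; field_simp [hTz z3]; ring
      rw [h, zero_mul] at h5
      exact mul_ne_zero hcA0 (hcs _ _ h13.symm) h5.symm
    have hTu : T ∈ IntermediateField.adjoin ℂ {u} := by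
      have hmu := IntermediateField.mem_adjoin_simple_self ℂ u
      have : T = (u * c z3 - c A * c z1) / (u - c A) := by
        rw [eq_div_iff huA, hu]; field_simp [hTz z3]; ring
      rw [this]
      exact div_mem (sub_mem (mul_mem hmu (hcm _ _)) (mul_mem (hcm _ _) (hcm _ _)))
        (sub_mem hmu (hcm _ _))
    have huE : u ∈ E := mul_mem (mul_mem (hcm _ _) (sub_mem hTE (hcm _ _)))
      (inv_mem (sub_mem hTE (hcm _ _)))
    refine no_unit_param_field C1 C2 u (hgen u hTu hC1E) (hgen u hTu hC2E) huE hu0 α δ hα hα0 s hsf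
      (Λ \ B) hΛ2 hC1 hC2 (fun l hl => ?_)
    obtain ⟨m, n, τ, k1, k2, k3, k4, k5⟩ := hpoint l hl
    have n12 : z2 - z1 ≠ 0 := sub_ne_zero.2 h12.symm
    have hw1 : 1 - A * (τ - z1) * (τ - z3)⁻¹ = (z1 - z3) / (z2 - z1) * (z2 - τ) * (τ - z3)⁻¹ := by
      have := k4 z3 h3
      rw [hA]; field_simp; ring
    have n2 : z2 - τ ≠ 0 := by
      have := k4 z2 h2
      rwa [← neg_sub, neg_ne_zero] at this
    refine ⟨m, n, A * (τ - z1) * (τ - z3)⁻¹, k1, k2,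
      ((EV.const l A).mul (k3.sub_const z1)).mul ((k3.sub_const z3).inv (k4 z3 h3)),
      mul_ne_zero (mul_ne_zero hA0 (k4 z1 h1)) (inv_ne_zero (k4 z3 h3)), ?_, fun V hV => ?_⟩
    · rw [hw1]
      exact mul_ne_zero (mul_ne_zero (div_ne_zero (sub_ne_zero.2 h13) n12) n2)
        (inv_ne_zero (k4 z3 h3))
    · rw [hw1, hA]
      simp only [map_mul, map_div₀, map_inv₀, hzz V hV z2 h2 z3 h3 h23,
        hzz V hV z2 h2 z1 h1 h12.symm, hzz V hV z1 h1 z3 h3 h13, div_one, one_mul,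
        Valuation.map_sub_swap V.valuation z2 τ]
      have hv0 : V.valuation (τ - z3) ≠ 0 := (Valuation.ne_zero_iff _).2 (k4 z3 h3)
      have hall : V.valuation (τ - z1) = V.valuation (τ - z3) ∧
          V.valuation (τ - z2) = V.valuation (τ - z3) := by
        rcases k5 V hV with h | ⟨_, _, h⟩
        · exact ⟨by rw [h z1 h1, h z3 h3], by rw [h z2 h2, h z3 h3]⟩
        · exact ⟨by rw [h z1 h1, h z3 h3], by rw [h z2 h2, h z3 h3]⟩
      rw [hall.1, hall.2]
      exact ⟨mul_inv_cancel₀ hv0, mul_inv_cancel₀ hv0⟩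
  · set A : ℂ := (z2 - z1)⁻¹ with hA
    have n12 : z2 - z1 ≠ 0 := sub_ne_zero.2 h12.symm
    have hA0 : A ≠ 0 := inv_ne_zero n12
    have hcA0 : c A ≠ 0 := fun h => hA0 (hcinj (by rw [h, map_zero]))
    set u : RatFunc ℂ := c A * (T - c z1) with hu
    have hu0 : u ≠ 0 := mul_ne_zero hcA0 (hTz _)
    have hTu : T ∈ IntermediateField.adjoin ℂ {u} := by
      have hmu := IntermediateField.mem_adjoin_simple_self ℂ u
      have : T = u / c A + c z1 := by
        rw [hu]; field_simp; ring
      rw [this]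
      exact add_mem (div_mem hmu (hcm _ _)) (hcm _ _)
    have huE : u ∈ E := mul_mem (hcm _ _) (sub_mem hTE (hcm _ _))
    refine no_unit_param_field C1 C2 u (hgen u hTu hC1E) (hgen u hTu hC2E) huE hu0 α δ hα hα0 s hsf
      (Λ \ B) hΛ2 hC1 hC2 (fun l hl => ?_)
    obtain ⟨m, n, τ, k1, k2, k3, k4, k5⟩ := hpoint l hl
    have hw1 : 1 - A * (τ - z1) = A * (z2 - τ) := by
      rw [hA]; field_simp; ring
    have n2 : z2 - τ ≠ 0 := by
      have := k4 z2 h2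
      rwa [← neg_sub, neg_ne_zero] at this
    refine ⟨m, n, A * (τ - z1), k1, k2, (EV.const l A).mul (k3.sub_const z1),
      mul_ne_zero hA0 (k4 z1 h1), ?_, fun V hV => ?_⟩
    · rw [hw1]; exact mul_ne_zero hA0 n2
    · rw [hw1, hA]
      simp only [map_mul, map_inv₀, hzz V hV z2 h2 z1 h1 h12.symm, inv_one, one_mul,
        Valuation.map_sub_swap V.valuation z2 τ]
      rcases k5 V hV with h | ⟨h, _⟩
      · exact ⟨h z1 h1, h z2 h2⟩
      · exact absurd h hsum

end part7


section part8

lemma affine_iter {R : Type*} [CommRing R] (a b a0 : R) (h : b = a0 * (1 - a)) (m : ℕ) (r : R) :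
    (fun r : R => a * r + b)^[m] r = a ^ m * (r - a0) + a0 := by
  induction m with
  | zero => simp
  | succ m ih =>
    rw [Function.iterate_succ_apply', ih, h]
    ring

lemma zpow_nonconst (C : RatFunc ℂ) (h : ∀ k, C ≠ algebraMap ℂ (RatFunc ℂ) k) (q : ℤ) (hq : q ≠ 0)
    (k : ℂ) : C ^ q ≠ algebraMap ℂ (RatFunc ℂ) k := by
  intro hk
  have ht : Transcendental ℂ C := RatFunc.transcendental_of_ne_C C (by
    rintro ⟨c, hc⟩; exact h c hc)
  have key : ∀ (n : ℕ) (k' : ℂ), n ≠ 0 → C ^ n ≠ algebraMap ℂ (RatFunc ℂ) k' := by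
    intro n k' hn hk'
    refine ht (IsAlgebraic.of_pow (n := n) (Nat.pos_of_ne_zero hn) ?_)
    rw [hk']; exact isAlgebraic_algebraMap _
  obtain ⟨n, rfl | rfl⟩ := q.eq_nat_or_neg
  · rw [zpow_natCast] at hk
    exact key n k (by simpa using hq) hk
  · rw [zpow_neg, zpow_natCast, inv_eq_iff_eq_inv, ← map_inv₀] at hk
    exact key n _ (by simpa using hq) hk

lemma exists_zpow_root (x : ℂ) (hx : x ≠ 0) (q : ℤ) (hq : q ≠ 0) : ∃ ρ : ℂ, ρ ≠ 0 ∧ ρ ^ q = x := by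
  have key : ∀ (n : ℕ) (y : ℂ), n ≠ 0 → y ≠ 0 → ∃ ρ : ℂ, ρ ≠ 0 ∧ ρ ^ n = y := by
    intro n y hn hy
    obtain ⟨ρ, hρ⟩ := IsAlgClosed.exists_pow_nat_eq y (Nat.pos_of_ne_zero hn)
    exact ⟨ρ, by rintro rfl; rw [zero_pow hn] at hρ; exact hy hρ.symm, hρ⟩
  obtain ⟨n, rfl | rfl⟩ := q.eq_nat_or_neg
  · obtain ⟨ρ, h0, h1⟩ := key n x (by simpa using hq) hx
    exact ⟨ρ, h0, by rw [zpow_natCast, h1]⟩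
  · obtain ⟨ρ, h0, h1⟩ := key n x⁻¹ (by simpa using hq) (inv_ne_zero hx)
    exact ⟨ρ, h0, by rw [zpow_neg, zpow_natCast, h1, inv_inv]⟩

lemma common_root (C1 C2 : RatFunc ℂ) (hC1 : ∀ k, C1 ≠ algebraMap ℂ (RatFunc ℂ) k)
    (hC2 : ∀ k, C2 ≠ algebraMap ℂ (RatFunc ℂ) k)
    (h : ∃ p q : ℤ, (p ≠ 0 ∨ q ≠ 0) ∧ ∃ k, C1 ^ p * C2 ^ q = algebraMap ℂ (RatFunc ℂ) k) :
    ∃ (F : RatFunc ℂ) (p q : ℤ) (μ : ℂ), p ≠ 0 ∧ q ≠ 0 ∧ IsCoprime p q ∧ μ ≠ 0 ∧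
      C1 ^ q * C2 ^ (-p) = algebraMap ℂ (RatFunc ℂ) (μ ^ q) ∧
      C1 = algebraMap ℂ (RatFunc ℂ) μ * F ^ p ∧ C2 = F ^ q := by
  set c := algebraMap ℂ (RatFunc ℂ) with hc
  have hne : ∀ C : RatFunc ℂ, (∀ k, C ≠ c k) → C ≠ 0 := fun C h h0 =>
    h 0 (by rw [h0, map_zero])
  have n1 := hne _ hC1
  have n2 := hne _ hC2
  obtain ⟨p, q, hpq, k, hk⟩ := h
  have hp : p ≠ 0 := by
    rintro rfl
    rw [zpow_zero, one_mul] at hk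
    exact zpow_nonconst C2 hC2 q (by simpa using hpq) k hk
  have hq : q ≠ 0 := by
    rintro rfl
    rw [zpow_zero, mul_one] at hk
    exact zpow_nonconst C1 hC1 p (by simpa using hpq) k hk
  obtain ⟨g, p', q', hg, hcop, hp', hq'⟩ : ∃ g p' q' : ℤ, g ≠ 0 ∧ IsCoprime p' q' ∧ p = p' * g ∧
      q = q' * g := by
    have hg : (Int.gcd p q : ℤ) ≠ 0 := by
      simp [Int.gcd_eq_zero_iff, hp]
    obtain ⟨a, ha⟩ := Int.gcd_dvd_left p q
    obtain ⟨b, hb⟩ := Int.gcd_dvd_right p q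
    refine ⟨Int.gcd p q, a, b, hg, ?_, by rw [mul_comm]; exact ha, by rw [mul_comm]; exact hb⟩
    refine ⟨Int.gcdA p q, Int.gcdB p q, ?_⟩
    have := Int.gcd_eq_gcd_ab p q
    apply mul_left_cancel₀ hg
    have e1 : (Int.gcd p q : ℤ) * (Int.gcdA p q * a + Int.gcdB p q * b) =
      (Int.gcd p q : ℤ) * a * Int.gcdA p q + (Int.gcd p q : ℤ) * b * Int.gcdB p q := by ring
    rw [e1, ← ha, ← hb, ← this, mul_one]
  have hconst : ∃ κ, C1 ^ p' * C2 ^ q' = c κ := by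
    by_contra hcon
    push Not at hcon
    refine zpow_nonconst _ hcon g hg k ?_
    rw [mul_zpow, ← zpow_mul, ← zpow_mul, ← hp', ← hq', hk]
  obtain ⟨κ, hκ⟩ := hconst
  have hp'0 : p' ≠ 0 := by rintro rfl; simp at hp'; exact hp hp'
  have hq'0 : q' ≠ 0 := by rintro rfl; simp at hq'; exact hq hq'
  have hκ0 : κ ≠ 0 := by
    rintro rfl
    rw [map_zero] at hκ
    exact mul_ne_zero (zpow_ne_zero _ n1) (zpow_ne_zero _ n2) hκ
  have hcκ : c κ ≠ 0 := by
    rw [← hκ]; exact mul_ne_zero (zpow_ne_zero _ n1) (zpow_ne_zero _ n2)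
  -- change of sign
  obtain ⟨P, rfl⟩ : ∃ P, q' = -P := ⟨-q', by ring⟩
  have hP : P ≠ 0 := by simpa using hq'0
  obtain ⟨b, a, hab⟩ := hcop
  obtain ⟨a, rfl⟩ : ∃ a', a = -a' := ⟨-a, by ring⟩
  have hab' : a * P + b * p' = 1 := by linarith
  obtain ⟨ρ, hρ0, hρ⟩ := exists_zpow_root (κ ^ a) (zpow_ne_zero _ hκ0) p' hp'0
  have hcρ : c ρ ≠ 0 := by
    intro h; exact hρ0 ((algebraMap ℂ (RatFunc ℂ)).injective (by rw [map_zero]; exact h))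
  have hκ' : C1 ^ p' = c κ * C2 ^ P := by
    rw [← hκ, mul_assoc, ← zpow_add₀ n2, neg_add_cancel, zpow_zero, mul_one]
  have hF0Q : (C1 ^ a * C2 ^ b) ^ p' = c κ ^ a * C2 := by
    rw [mul_zpow, ← zpow_mul, mul_comm a, zpow_mul, hκ', mul_zpow, ← zpow_mul, ← zpow_mul, mul_assoc,
      ← zpow_add₀ n2, show P * a + b * p' = 1 by linarith, zpow_one]
  have hF0P : c κ ^ b * (C1 ^ a * C2 ^ b) ^ P = C1 := by
    have : c κ ^ b * (C1 ^ a * C2 ^ b) ^ P = C1 ^ (a * P) * (c κ * C2 ^ P) ^ b := by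
      rw [mul_zpow, mul_zpow, ← zpow_mul, ← zpow_mul, ← zpow_mul, mul_comm b P]; ring
    rw [this, ← hκ', ← zpow_mul, ← zpow_add₀ n1, mul_comm p', hab', zpow_one]
  refine ⟨C1 ^ a * C2 ^ b / c ρ, P, p', κ ^ b * ρ ^ P, hP, hp'0, ⟨a, b, hab'⟩,
    mul_ne_zero (zpow_ne_zero _ hκ0) (zpow_ne_zero _ hρ0), ?_, ?_, ?_⟩
  · rw [hκ, mul_zpow, ← zpow_mul, ← zpow_mul, mul_comm P, zpow_mul ρ, hρ, ← zpow_mul,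
      ← zpow_add₀ hκ0, show b * p' + a * P = 1 by linarith, zpow_one]
  · rw [map_mul, map_zpow₀, map_zpow₀, div_zpow, mul_assoc, mul_div_cancel₀ _ (zpow_ne_zero _ hcρ), hF0P]
  · rw [div_zpow, hF0Q, ← map_zpow₀, ← map_zpow₀, hρ, mul_div_cancel_left₀]
    rw [map_zpow₀]; exact zpow_ne_zero _ hcκ

lemma quotient_ev (α β a0 : ℂ) (ha : β = a0 * (1 - α)) (f : ℂ → ℂ)
    (hf : ∀ x, f x = α * x + β) (c : RatFunc ℂ) (l : ℂ) (hl : l ≠ a0) (hd : c.denom.eval l ≠ 0)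
    (m : ℕ) (h : f^[m] l = c.eval (RingHom.id ℂ) l) :
    EV l ((c - algebraMap ℂ (RatFunc ℂ) a0) * (RatFunc.X - algebraMap ℂ (RatFunc ℂ) a0)⁻¹) (α ^ m) := by
  have h1 := EV.of_eval hd
  have hf2 : f = fun x => α * x + β := funext hf
  rw [← h, hf2, affine_iter α β a0 ha] at h1
  have hX : EV l RatFunc.X l := by
    have := EV.alg l X
    rwa [RatFunc.algebraMap_X, eval_X] at this
  have hl0 : l - a0 ≠ 0 := sub_ne_zero.2 hl
  have := (h1.sub_const a0).mul ((hX.sub_const a0).inv hl0)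
  rwa [add_sub_cancel_right, mul_assoc, mul_inv_cancel₀ hl0, mul_one] at this

lemma X_sub_ne (a : ℂ) : (RatFunc.X : RatFunc ℂ) - algebraMap ℂ (RatFunc ℂ) a ≠ 0 := by
  have : (RatFunc.X : RatFunc ℂ) - algebraMap ℂ (RatFunc ℂ) a = algebraMap ℂ[X] (RatFunc ℂ) (X - C a) := by
    rw [map_sub, RatFunc.algebraMap_X, RatFunc.algebraMap_C]; rfl
  rw [this]
  exact ratfunc_map_ne (X_sub_C_ne_zero a)

lemma quotient_nonconst (α β a0 : ℂ) (ha : β = a0 * (1 - α)) (c : RatFunc ℂ)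
    (hc : ∀ m : ℕ, 1 ≤ m →
      c ≠ (fun r : RatFunc ℂ => RatFunc.C α * r + RatFunc.C β)^[m] RatFunc.X) (l : ℂ) (m : ℕ)
    (hm : 1 ≤ m)
    (h : EV l ((c - algebraMap ℂ (RatFunc ℂ) a0) * (RatFunc.X - algebraMap ℂ (RatFunc ℂ) a0)⁻¹) (α ^ m))
    (k : ℂ) : (c - algebraMap ℂ (RatFunc ℂ) a0) * (RatFunc.X - algebraMap ℂ (RatFunc ℂ) a0)⁻¹ ≠
      algebraMap ℂ (RatFunc ℂ) k := by
  intro hk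
  rw [hk] at h
  have hkm := (EV.const l k).unique h
  subst hkm
  apply hc m hm
  rw [affine_iter (RatFunc.C α) (RatFunc.C β) (RatFunc.C a0) (by rw [ha]; simp)]
  rw [← div_eq_mul_inv, div_eq_iff (X_sub_ne a0), map_pow] at hk
  rw [← sub_eq_iff_eq_add]
  exact hk

end part8


end MainMaterial

/-- Proposition 2.2: classification when both multipliers differ from 1. -/
theorem stmt3 (α δ β γ : ℂ) (hα : α ≠ 0) (hδ : δ ≠ 0) (hα1 : α ≠ 1) (hδ1 : δ ≠ 1)
    (f g : ℂ → ℂ)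
    (hf : ∀ x, f x = α * x + β) (hg : ∀ x, g x = δ * x + γ)
    (c₁ c₂ : RatFunc ℂ)
    (hc₁ : ∀ m : ℕ, 1 ≤ m →
      c₁ ≠ (fun r : RatFunc ℂ => RatFunc.C α * r + RatFunc.C β)^[m] RatFunc.X)
    (hc₂ : ∀ n : ℕ, 1 ≤ n →
      c₂ ≠ (fun r : RatFunc ℂ => RatFunc.C δ * r + RatFunc.C γ)^[n] RatFunc.X)
    (hinf : {l : ℂ | c₁.denom.eval l ≠ 0 ∧ c₂.denom.eval l ≠ 0 ∧
        ∃ m n : ℕ, 1 ≤ m ∧ 1 ≤ n ∧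
          f^[m] l = c₁.eval (RingHom.id ℂ) l ∧
          g^[n] l = c₂.eval (RingHom.id ℂ) l}.Infinite) :
    ∃ F : RatFunc ℂ, (∀ k : ℂ, F ≠ RatFunc.C k) ∧
    ∃ p q : ℤ, p ≠ 0 ∧ q ≠ 0 ∧ IsCoprime p q ∧
    ∃ μ : ℂ, μ ≠ 0 ∧
      {mn : ℕ × ℕ | 1 ≤ mn.1 ∧ 1 ≤ mn.2 ∧
        μ ^ q = α ^ ((mn.1 : ℤ) * q) * δ ^ (-((mn.2 : ℤ) * p))}.Infinite ∧
      c₁ = RatFunc.C μ * F ^ p * (RatFunc.X - RatFunc.C (β / (1 - α))) +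
        RatFunc.C (β / (1 - α)) ∧
      c₂ = F ^ q * (RatFunc.X - RatFunc.C (γ / (1 - δ))) + RatFunc.C (γ / (1 - δ)) := by
  classical
  set a0 := β / (1 - α) with ha0
  set b0 := γ / (1 - δ) with hb0
  have ha : β = a0 * (1 - α) := (div_mul_cancel₀ _ (sub_ne_zero.2 hα1.symm)).symm
  have hb : γ = b0 * (1 - δ) := (div_mul_cancel₀ _ (sub_ne_zero.2 hδ1.symm)).symm
  set C1 : RatFunc ℂ := (c₁ - algebraMap ℂ (RatFunc ℂ) a0) *
    (RatFunc.X - algebraMap ℂ (RatFunc ℂ) a0)⁻¹ with hC1def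
  set C2 : RatFunc ℂ := (c₂ - algebraMap ℂ (RatFunc ℂ) b0) *
    (RatFunc.X - algebraMap ℂ (RatFunc ℂ) b0)⁻¹ with hC2def
  have hΛ := hinf.sdiff (Set.toFinite ({a0, b0} : Set ℂ))
  set Λ : Set ℂ := {l : ℂ | c₁.denom.eval l ≠ 0 ∧ c₂.denom.eval l ≠ 0 ∧
        ∃ m n : ℕ, 1 ≤ m ∧ 1 ≤ n ∧
          f^[m] l = c₁.eval (RingHom.id ℂ) l ∧
          g^[n] l = c₂.eval (RingHom.id ℂ) l} \ {a0, b0} with hΛdef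
  have hpt : ∀ l ∈ Λ, ∃ m n : ℕ, 1 ≤ m ∧ 1 ≤ n ∧ EV l C1 (α ^ m) ∧ EV l C2 (δ ^ n) := by
    rintro l ⟨⟨d1, d2, m, n, hm, hn, e1, e2⟩, hl⟩
    simp only [Set.mem_insert_iff, Set.mem_singleton_iff, not_or] at hl
    exact ⟨m, n, hm, hn, quotient_ev α β a0 ha f hf c₁ l hl.1 d1 m e1,
      quotient_ev δ γ b0 hb g hg c₂ l hl.2 d2 n e2⟩
  obtain ⟨l0, hl0⟩ := hΛ.nonempty
  obtain ⟨m0, n0, hm0, hn0, hev1, hev2⟩ := hpt l0 hl0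
  have hC1 : ∀ k, C1 ≠ algebraMap ℂ (RatFunc ℂ) k := quotient_nonconst α β a0 ha c₁ hc₁ l0 m0 hm0 hev1
  have hC2 : ∀ k, C2 ≠ algebraMap ℂ (RatFunc ℂ) k := quotient_nonconst δ γ b0 hb c₂ hc₂ l0 n0 hn0 hev2
  have hroot : ∀ n : ℕ, 1 ≤ n → α ^ n ≠ 1 := by
    intro n hn h1
    have hfin : (⋃ i ∈ Finset.range n, {l | EV l C1 (α ^ i)}).Finite :=
      Set.Finite.biUnion (Finset.range n).finite_toSet (fun i _ => EV.fiber_finite (hC1 _))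
    refine hΛ (hfin.subset (fun l hl => ?_))
    obtain ⟨m, _, _, _, h2, _⟩ := hpt l hl
    refine Set.mem_biUnion (x := m % n) (by simp; exact Nat.mod_lt _ hn) ?_
    have h3 : α ^ m = α ^ (m % n) := by
      conv_lhs => rw [← Nat.div_add_mod m n, pow_add, pow_mul, h1, one_pow, one_mul]
    rw [h3] at h2
    exact h2
  obtain ⟨F, p, q, μ, hp, hq, hcop, hμ, hrel, hF1, hF2⟩ := common_root C1 C2 hC1 hC2
    (dependent_core C1 C2 α δ hroot hα hδ Λ hΛ hC1 hC2 (fun l hl => by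
      obtain ⟨m, n, _, _, h1, h2⟩ := hpt l hl
      exact ⟨m, n, h1, h2⟩))
  refine ⟨F, ?_, p, q, hp, hq, hcop, μ, hμ, ?_, ?_, ?_⟩
  · intro k hk
    apply hC2 (k ^ q)
    rw [hF2, hk, map_zpow₀]; rfl
  · intro hfin
    have hfin2 := Set.Finite.biUnion (t := fun mn : ℕ × ℕ => {l | EV l C1 (α ^ mn.1)}) hfin
      (fun mn _ => EV.fiber_finite (hC1 _))
    refine hΛ (hfin2.subset (fun l hl => ?_))
    obtain ⟨m, n, hm, hn, h1, h2⟩ := hpt l hl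
    refine Set.mem_biUnion (x := (m, n)) ⟨hm, hn, ?_⟩ h1
    have h3 := (h1.zpow (pow_ne_zero _ hα) q).mul (h2.zpow (pow_ne_zero _ hδ) (-p))
    rw [hrel] at h3
    have h4 := (EV.const l (μ ^ q)).unique h3
    rw [h4, zpow_mul, zpow_natCast, ← mul_neg, zpow_mul, zpow_natCast]
  · have h1 : C1 * (RatFunc.X - algebraMap ℂ (RatFunc ℂ) a0) = c₁ - algebraMap ℂ (RatFunc ℂ) a0 := by
      rw [hC1def, mul_assoc, inv_mul_cancel₀ (X_sub_ne a0), mul_one]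
    rw [hF1] at h1
    rw [← sub_eq_iff_eq_add]
    exact h1.symm
  · have h1 : C2 * (RatFunc.X - algebraMap ℂ (RatFunc ℂ) b0) = c₂ - algebraMap ℂ (RatFunc ℂ) b0 := by
      rw [hC2def, mul_assoc, inv_mul_cancel₀ (X_sub_ne b0), mul_one]
    rw [hF2] at h1
    rw [← sub_eq_iff_eq_add]
    exact h1.symm
end

section
/- Let α ∈ ℂ be nonzero and transcendental over ℚ, let β, γ ∈ ℂ, and define f(x) = αx + β and g(x) = x + γ. Let c₁, c₂ ∈ ℂ(x) be rational functions such that c₁ ≠ f^m in ℂ(x) for every integer m ≥ 1 and c₂ ≠ g^n in ℂ(x) for every integer n ≥ 1. Then the set of λ ∈ ℂ that are not poles of c₁ or c₂ and for which there exist integers m, n ≥ 1 with f^m(λ) = c₁(λ) and g^n(λ) = c₂(λ) is finite. -/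
open Polynomial in
lemma aux_dvd {R S : Type*} [CommRing R] [IsDomain R] [CommRing S] [IsDomain S] [Algebra R S]
    [Algebra.IsAlgebraic R S] (P : S[X][X]) (hP : P ≠ 0) :
    ∃ Q : R[X][X], Q ≠ 0 ∧ P ∣ Q.map (mapRingHom (algebraMap R S)) := by
  let _ : Algebra R[X] S[X] := Polynomial.algebra R S
  exact Polynomial.exists_dvd_map_of_isAlgebraic (R := R[X]) (S := S[X]) hP

open Polynomial in
lemma aux_sparse {k : Type*} [CommRing k] (R : k[X][X]) (B m : ℕ)
    (hB : ∀ i, (R.coeff i).natDegree ≤ B) (hm : B < m) (h : R.eval (X ^ m) = 0) : R = 0 := by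
  by_contra hR
  set d := R.natDegree with hd
  set e := (R.coeff d).natDegree with he
  have h1 : (R.eval (X ^ m)).coeff (m * d + e) = 0 := by rw [h]; simp
  rw [eval_eq_sum_range, finsetSum_coeff, Finset.sum_range_succ, Finset.sum_eq_zero] at h1
  · rw [← pow_mul, zero_add, add_comm, coeff_mul_X_pow] at h1
    apply hR
    rw [← leadingCoeff_eq_zero, leadingCoeff, ← leadingCoeff_eq_zero, leadingCoeff]
    exact h1
  · intro i hi
    have hi' : i < d := Finset.mem_range.mp hi
    obtain ⟨j, hj⟩ := Nat.exists_eq_add_of_lt hi'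
    have : m * d + e = (m * (j + 1) + e) + m * i := by rw [hj]; ring
    rw [← pow_mul, this, coeff_mul_X_pow]
    apply coeff_eq_zero_of_natDegree_lt
    have := hB i
    nlinarith

open Polynomial in
lemma aux_key (α : ℂ) (htr : Transcendental ℚ α) (P : ℂ[X][X]) (hP : P ≠ 0) :
    ∃ (N : Set ℕ) (M : ℕ), N.Finite ∧ ∀ m n : ℕ, P.evalEval (n : ℂ) (α ^ m) = 0 → n ∈ N ∨ m ≤ M := by
  obtain ⟨t, hst, ht⟩ := exists_isTranscendenceBasis_superset (R := ℚ) (s := {α})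
    ((algebraicIndependent_singleton_iff (ι := ({α} : Set ℂ)) (x := fun i => (i : ℂ)) ⟨α, rfl⟩).2 htr)
  have hαt : α ∈ t := hst rfl
  let A := Algebra.adjoin ℚ (t \ {α})
  have hαA : Transcendental A α := by
    have := (AlgebraicIndepOn.insert_iff (R := ℚ) (x := (id : ℂ → ℂ)) (s := t \ {α}) (i := α) (by simp)).1
      (by rw [Set.insert_sdiff_singleton, Set.insert_eq_of_mem hαt]; exact ht.1)
    have h2 := this.2
    rw [Set.image_id] at h2
    exact h2
  let _ : Algebra A[X] ℂ := (aeval (R := A) α).toRingHom.toAlgebra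
  have hmap : ∀ q : A[X], algebraMap A[X] ℂ q = aeval α q := fun q => rfl
  have halg : Algebra.IsAlgebraic A[X] ℂ := by
    have h1 := ht.isAlgebraic
    constructor
    intro z
    have h2 := h1.isAlgebraic z
    rw [Subtype.range_coe] at h2
    have hle : ∀ w ∈ Algebra.adjoin ℚ t, ∃ q : A[X], aeval α q = w := by
      intro w hw
      induction hw using Algebra.adjoin_induction with
      | mem x hx =>
        by_cases hxa : x = α
        · exact ⟨X, by simp [hxa]⟩
        · exact ⟨C ⟨x, Algebra.subset_adjoin ⟨hx, hxa⟩⟩, by simp⟩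
      | algebraMap r => exact ⟨C (algebraMap ℚ A r), by rw [aeval_C]; rfl⟩
      | add x y _ _ h1 h2 =>
        obtain ⟨a, rfl⟩ := h1
        obtain ⟨b, rfl⟩ := h2
        exact ⟨a + b, by simp⟩
      | mul x y _ _ h1 h2 =>
        obtain ⟨a, rfl⟩ := h1
        obtain ⟨b, rfl⟩ := h2
        exact ⟨a * b, by simp⟩
    have hsurj : ∀ w : Algebra.adjoin ℚ t, ∃ q : A[X], aeval α q = (w : ℂ) := fun w => hle w w.2
    choose g hg using hsurj
    obtain ⟨p, hp0, hp⟩ := h2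
    have hginj : ∀ w, g w = 0 ↔ w = 0 := by
      intro w
      constructor
      · intro h
        have := hg w
        rw [h, map_zero] at this
        exact Subtype.ext this.symm
      · rintro rfl
        have := hg 0
        exact (transcendental_iff.1 hαA) _ (by simpa using this)
    refine ⟨∑ i ∈ p.support, monomial i (g (p.coeff i)), ?_, ?_⟩
    · intro h
      apply hp0
      ext1 i
      have := congrArg (fun q => q.coeff i) h
      simp only [finsetSum_coeff, coeff_monomial, Finset.sum_ite_eq', coeff_zero] at this
      by_cases hi : i ∈ p.support
      · rw [if_pos hi, hginj] at this
        simpa using this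
      · simpa using hi
    · rw [map_sum]
      rw [aeval_eq_sum_range, ← Polynomial.sum_over_range' (f := fun i a => a • z ^ i) p (by simp) _ (Nat.lt_succ_self _), Polynomial.sum] at hp
      rw [← hp]
      refine Finset.sum_congr rfl fun i _ => ?_
      rw [aeval_monomial, hmap, hg]
      rfl
  have hinj : Function.Injective (algebraMap A[X] ℂ) := transcendental_iff_injective.1 hαA
  obtain ⟨Q, hQ0, hQ⟩ := aux_dvd (R := A[X]) P hP
  let q := Q.leadingCoeff
  have hq : q ≠ 0 := leadingCoeff_ne_zero.2 hQ0
  let B := Q.support.sup fun i => (Q.coeff i).support.sup fun j => ((Q.coeff i).coeff j).natDegree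
  refine ⟨{n : ℕ | q.IsRoot (n : A[X])}, B, ?_, ?_⟩
  · exact Set.Finite.preimage (Nat.cast_injective.injOn) (finite_setOfPred_isRoot hq)
  · intro m n h
    by_contra! hcon
    obtain ⟨hn, hm⟩ := hcon
    apply hn
    have hz : Q.evalEval (n : A[X]) (X ^ m) = 0 := by
      apply hinj
      rw [map_zero]
      obtain ⟨T, hT⟩ := hQ
      have h2 : (Q.map (mapRingHom (algebraMap A[X] ℂ))).evalEval (n : ℂ) (α ^ m) = 0 := by
        rw [hT, evalEval_mul, h, zero_mul]
      have h3 := map_mapRingHom_evalEval (algebraMap A[X] ℂ) Q (n : A[X]) (X ^ m)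
      rw [← h3, ← h2]
      congr 1
      · simp
      · simp [hmap]
    have hR := aux_sparse (Q.map (evalRingHom (n : A[X]))) B m ?_ hm ?_
    · have := congrArg (fun q => q.coeff Q.natDegree) hR
      simpa [q, IsRoot] using this
    · intro i
      rw [coeff_map, coe_evalRingHom, eval_eq_sum, Polynomial.sum]
      apply natDegree_sum_le_of_forall_le
      intro j hj
      have h1 : ((n : A[X]) ^ j).natDegree = 0 := by
        rw [← Nat.cast_pow, natDegree_natCast]
      refine natDegree_mul_le.trans ?_
      rw [h1, add_zero]
      have hi : i ∈ Q.support := by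
        rw [mem_support_iff]; intro h; simp [h] at hj
      refine le_trans ?_ (Finset.le_sup (f := fun i => (Q.coeff i).support.sup fun j => ((Q.coeff i).coeff j).natDegree) hi)
      exact Finset.le_sup (f := fun j => ((Q.coeff i).coeff j).natDegree) hj
    · rw [← hz]
      rw [evalEval, ← coe_evalRingHom, ← coe_evalRingHom, ← coe_evalRingHom]
      rw [coe_evalRingHom, eval_map, coe_evalRingHom, coe_evalRingHom, ← coe_evalRingHom (n : A[X]), eval, hom_eval₂]
      simp

open Polynomial in
lemma aux_dep (N₁ D₁ N₂ D₂ : ℂ[X]) (h₁ : D₁ ≠ 0) (h₂ : D₂ ≠ 0) :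
    ∃ P : ℂ[X][X], P ≠ 0 ∧ ∀ l : ℂ, D₁.eval l ≠ 0 → D₂.eval l ≠ 0 →
      P.evalEval (N₂.eval l / D₂.eval l) (N₁.eval l / D₁.eval l) = 0 := by
  let S := Submonoid.powers (D₁ * D₂)
  have hS : S ≤ nonZeroDivisors ℂ[X] := powers_le_nonZeroDivisors_of_noZeroDivisors (mul_ne_zero h₁ h₂)
  let W := Localization S
  have : IsDomain W := IsLocalization.isDomain_localization hS
  have : FaithfulSMul ℂ[X] W := (faithfulSMul_iff_algebraMap_injective _ _).2 (IsLocalization.injective W hS)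
  have : Algebra.IsAlgebraic ℂ[X] W := IsLocalization.isAlgebraic _ S
  have ht : Algebra.trdeg ℂ W = 1 := by
    rw [← trdeg_add_eq ℂ ℂ[X], Polynomial.trdeg_of_isDomain, trdeg_eq_zero, add_zero]
  have ht2 : Algebra.trdeg ℂ ℂ[X][X] = 2 := by
    rw [← trdeg_add_eq ℂ ℂ[X], Polynomial.trdeg_of_isDomain, Polynomial.trdeg_of_isDomain,
      one_add_one_eq_two]
  let dd : S := ⟨D₁ * D₂, Submonoid.mem_powers _⟩
  let s : W := Localization.mk (N₁ * D₂) dd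
  let r : W := Localization.mk (N₂ * D₁) dd
  let φ : ℂ[X][X] →ₐ[ℂ] W := aevalAeval r s
  have hφ : ¬ Function.Injective φ := by
    intro h
    have := trdeg_le_of_injective φ h
    rw [ht, ht2] at this
    norm_num at this
  rw [injective_iff_map_eq_zero] at hφ
  push Not at hφ
  obtain ⟨P, hP, hP0⟩ := hφ
  refine ⟨P, hP0, fun l e₁ e₂ => ?_⟩
  have hu : ∀ y : S, IsUnit (evalRingHom l (y : ℂ[X])) := by
    rintro ⟨y, k, rfl⟩
    simp [e₁, e₂]
  let ψ : W →+* ℂ := IsLocalization.lift (M := S) hu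
  have hψ : ∀ a, ψ (Localization.mk a dd) = a.eval l / (D₁.eval l * D₂.eval l) := by
    intro a
    rw [Localization.mk_eq_mk']
    rw [IsLocalization.lift_mk'_spec, eq_comm]
    simp [dd]
    field_simp
  have key : ψ.comp φ.toRingHom = evalEvalRingHom (N₂.eval l / D₂.eval l) (N₁.eval l / D₁.eval l) := by
    apply ringHom_ext'
    · apply ringHom_ext
      · intro a
        have : ψ (algebraMap ℂ W a) = a := by
          rw [IsScalarTower.algebraMap_apply ℂ ℂ[X] W, IsLocalization.lift_eq]
          simp
        simpa [φ] using this
      · simp [φ, r, hψ]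
        field_simp
    · simp [φ, s, hψ]
      field_simp
  have := congrArg (fun g => g P) key
  simp [hP] at this
  exact this.symm

open Polynomial in
theorem stmt5 (α : ℂ) (hα : α ≠ 0) (htr : Transcendental ℚ α) (β γ : ℂ)
    (f g : ℂ → ℂ)
    (hf : ∀ x, f x = α * x + β) (hg : ∀ x, g x = x + γ)
    (c₁ c₂ : RatFunc ℂ)
    (hc₁ : ∀ m : ℕ, 1 ≤ m →
      c₁ ≠ (fun r : RatFunc ℂ => RatFunc.C α * r + RatFunc.C β)^[m] RatFunc.X)
    (hc₂ : ∀ n : ℕ, 1 ≤ n →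
      c₂ ≠ (fun r : RatFunc ℂ => r + RatFunc.C γ)^[n] RatFunc.X) :
    {l : ℂ | c₁.denom.eval l ≠ 0 ∧ c₂.denom.eval l ≠ 0 ∧
        ∃ m n : ℕ, 1 ≤ m ∧ 1 ≤ n ∧
          f^[m] l = c₁.eval (RingHom.id ℂ) l ∧
          g^[n] l = c₂.eval (RingHom.id ℂ) l}.Finite := by
  have hα1 : α - 1 ≠ 0 := by
    intro h
    have : α = 1 := by linear_combination h
    exact htr (this ▸ isAlgebraic_one)
  obtain ⟨p, hp⟩ : ∃ p : ℂ, α * p + β = p := ⟨-β / (α - 1), by field_simp; ring⟩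
  have hd₁ := c₁.denom_ne_zero
  have hd₂ := c₂.denom_ne_zero
  have hfm : ∀ (m : ℕ) l, f^[m] l = α ^ m * (l - p) + p := by
    intro m l
    induction m with
    | zero => simp
    | succ m ih => rw [Function.iterate_succ_apply', ih, hf]; linear_combination hp
  have hgn : ∀ (n : ℕ) l, g^[n] l = l + n * γ := by
    intro n l
    induction n with
    | zero => simp
    | succ n ih => rw [Function.iterate_succ_apply', ih, hg]; push_cast; ring
  have hpX : RatFunc.C α * RatFunc.C p + RatFunc.C β = RatFunc.C p := by
    rw [← map_mul, ← map_add, hp]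
  have hFm : ∀ m : ℕ, (fun r : RatFunc ℂ => RatFunc.C α * r + RatFunc.C β)^[m] RatFunc.X
      = RatFunc.C α ^ m * (RatFunc.X - RatFunc.C p) + RatFunc.C p := by
    intro m
    induction m with
    | zero => simp
    | succ m ih => rw [Function.iterate_succ_apply', ih]; linear_combination hpX
  have hGn : ∀ n : ℕ, (fun r : RatFunc ℂ => r + RatFunc.C γ)^[n] RatFunc.X
      = RatFunc.X + (n : RatFunc ℂ) * RatFunc.C γ := by
    intro n
    induction n with
    | zero => simp
    | succ n ih => rw [Function.iterate_succ_apply', ih]; push_cast; ring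
  have hmk : ∀ (c : RatFunc ℂ) (q : ℂ[X]), c.num - q * c.denom = 0 →
      c = algebraMap ℂ[X] (RatFunc ℂ) q := by
    intro c q h
    have hne : algebraMap ℂ[X] (RatFunc ℂ) c.denom ≠ 0 := by
      simpa using c.denom_ne_zero
    have h2 := RatFunc.num_div_denom c
    rw [div_eq_iff hne, sub_eq_zero.1 h, map_mul] at h2
    exact (mul_right_cancel₀ hne h2).symm
  let F : ℕ → ℂ[X] := fun m => c₁.num - (C α ^ m * (X - C p) + C p) * c₁.denom
  let G : ℕ → ℂ[X] := fun n => c₂.num - (X + (n : ℂ[X]) * C γ) * c₂.denom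
  have hF : ∀ m, 1 ≤ m → F m ≠ 0 := by
    intro m hm h
    apply hc₁ m hm
    rw [hFm, hmk _ _ h]
    simp [RatFunc.algebraMap_X, RatFunc.algebraMap_C]
  have hG : ∀ n, 1 ≤ n → G n ≠ 0 := by
    intro n hn h
    apply hc₂ n hn
    rw [hGn, hmk _ _ h]
    simp [RatFunc.algebraMap_X, RatFunc.algebraMap_C]
  have hFl : ∀ l m, c₁.denom.eval l ≠ 0 → f^[m] l = c₁.eval (RingHom.id ℂ) l →
      c₁.num.eval l = (α ^ m * (l - p) + p) * c₁.denom.eval l := by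
    intro l m h0 h
    rw [hfm, RatFunc.eval, eval₂_id, eval₂_id, eq_div_iff h0] at h
    exact h.symm
  have hGl : ∀ l n, c₂.denom.eval l ≠ 0 → g^[n] l = c₂.eval (RingHom.id ℂ) l →
      c₂.num.eval l = (l + n * γ) * c₂.denom.eval l := by
    intro l n h0 h
    rw [hgn, RatFunc.eval, eval₂_id, eval₂_id, eq_div_iff h0] at h
    exact h.symm
  by_cases hγ : γ = 0
  · refine (finite_setOfPred_isRoot (hG 1 le_rfl)).subset ?_
    rintro l ⟨-, h2, m, n, hm, hn, -, h⟩
    have := hGl l n h2 h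
    simp only [Set.mem_ofPred_eq, IsRoot, G]
    simp [this, hγ]
  · obtain ⟨P, hP0, hP⟩ := aux_dep (c₁.num - C p * c₁.denom) ((X - C p) * c₁.denom)
      (c₂.num - X * c₂.denom) (C γ * c₂.denom)
      (mul_ne_zero (X_sub_C_ne_zero p) hd₁) (mul_ne_zero (by simpa using hγ) hd₂)
    obtain ⟨N, M, hN, hNM⟩ := aux_key α htr P hP0
    have hfin : ({p} ∪ ((⋃ m ∈ Set.Icc 1 M, {l | (F m).IsRoot l}) ∪
        ⋃ n ∈ N ∩ Set.Ici 1, {l | (G n).IsRoot l})).Finite := by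
      refine (Set.finite_singleton p).union (Set.Finite.union ?_ ?_)
      · exact (Set.finite_Icc 1 M).biUnion fun m hm => finite_setOfPred_isRoot (hF m hm.1)
      · exact (hN.inter_of_left _).biUnion fun n hn => finite_setOfPred_isRoot (hG n hn.2)
    refine hfin.subset ?_
    rintro l ⟨h1, h2, m, n, hm, hn, e1, e2⟩
    by_cases hlp : l = p
    · left; exact hlp
    right
    have hlp' : l - p ≠ 0 := sub_ne_zero.2 hlp
    have k1 := hFl l m h1 e1
    have k2 := hGl l n h2 e2
    have hz := hP l (by simp [hlp', h1]) (by simp [hγ, h2])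
    have a1 : (c₁.num - C p * c₁.denom).eval l / ((X - C p) * c₁.denom).eval l = α ^ m := by
      rw [div_eq_iff (by simp [hlp', h1])]
      simp only [eval_sub, eval_mul, eval_C, eval_X, k1]
      ring
    have a2 : (c₂.num - X * c₂.denom).eval l / (C γ * c₂.denom).eval l = n := by
      rw [div_eq_iff (by simp [hγ, h2])]
      simp only [eval_sub, eval_mul, eval_C, eval_X, k2]
      ring
    rw [a1, a2] at hz
    rcases hNM m n hz with h | h
    · right
      simp only [Set.mem_iUnion]
      refine ⟨n, ⟨h, hn⟩, ?_⟩
      simp [IsRoot, G, k2]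
    · left
      simp only [Set.mem_iUnion]
      refine ⟨m, ⟨hm, h⟩, ?_⟩
      simp [IsRoot, F, k1]
end
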